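/- arXiv:2601.20264 — 4 statements merged into one kernel-verified Lean document; each statement's English description precedes it below -/
import Mathlib

section
/- Let K be a number field and let β ∈ K be neither zero nor a root of unity. Then for all sufficiently large positive integers n, every γ ∈ ℚ̄ with γ^n = β satisfies [K(γ) : K] ≥ √n / [K:ℚ]. -/
/-!
Statement 8: if `β ∈ K` is neither zero nor a root of unity, then for all
sufficiently large `n`, every `n`-th root `γ` of `β` satisfies
`[K(γ):K] ≥ √n / [K:ℚ]`.
-/

noncomputable abbrev Qbar := AlgebraicClosure ℚ

open Height in
/-- In a number field, heights of nonzero elements that are not roots of unity are bounded below. -/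
theorem height_lower {F : Type*} [Field F] [NumberField F] :
    ∃ M : ℕ, ∀ δ : F, δ ≠ 0 → (∀ k : ℕ, k ≠ 0 → δ ^ k ≠ 1) → 1 < M * logHeight₁ δ := by
  have hfin := NumberField.finite_setOfPred_logHeight₁_le F 1
  refine ⟨hfin.toFinset.card, fun δ h0 hru => ?_⟩
  by_contra hle
  push Not at hle
  have hmap : Set.MapsTo (fun k : ℕ => δ ^ k)
      (Finset.range (hfin.toFinset.card + 1) : Set ℕ) (hfin.toFinset : Set F) := by
    intro k hk
    have hk' : (k : ℝ) ≤ hfin.toFinset.card := by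
      have : k < hfin.toFinset.card + 1 := by simpa using hk
      exact_mod_cast Nat.lt_succ_iff.mp this
    have hnn : 0 ≤ logHeight₁ δ := zero_le_logHeight₁ δ
    have : logHeight₁ (δ ^ k) ≤ 1 := by
      rw [logHeight₁_pow]
      exact (mul_le_mul_of_nonneg_right hk' hnn).trans hle
    simpa using this
  obtain ⟨i, -, j, -, hij, heq⟩ := Finset.exists_ne_map_eq_of_card_lt_of_maps_to
    (by simp) hmap
  have key : ∀ i j : ℕ, i < j → δ ^ i = δ ^ j → False := by
    intro i j hlt h
    apply hru (j - i) (by omega)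
    have : δ ^ i * δ ^ (j - i) = δ ^ i * 1 := by
      rw [← pow_add, mul_one, h]; congr 1; omega
    exact mul_left_cancel₀ (pow_ne_zero _ h0) this
  rcases lt_or_gt_of_ne hij with h | h
  · exact key i j h heq
  · exact key j i h heq.symm

/-- Taking norms of an `n`-th root. -/
theorem norm_pow_root {F L : Type*} [Field F] [Field L] [Algebra F L] (β : F) (g : L) (n : ℕ)
    (hg : g ^ n = algebraMap F L β) : (Algebra.norm F g) ^ n = β ^ Module.finrank F L := by
  rw [← map_pow, hg, Algebra.norm_algebraMap]

open Height in
theorem stmt_8 (K : IntermediateField ℚ Qbar) [NumberField ↥K]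
    (β : ↥K) (hβ0 : β ≠ 0) (hβru : ∀ k : ℕ, k ≠ 0 → β ^ k ≠ 1) :
    ∃ N : ℕ, ∀ n : ℕ, N ≤ n → 0 < n →
      ∀ γ : Qbar, γ ^ n = algebraMap ↥K Qbar β →
        Real.sqrt n / (Module.finrank ℚ ↥K : ℝ) ≤
          (Module.finrank ↥K ↥(IntermediateField.adjoin ↥K {γ}) : ℝ) := by
  obtain ⟨M, hM⟩ := height_lower (F := K)
  have hβh : 0 ≤ logHeight₁ β := zero_le_logHeight₁ β
  refine ⟨⌈(M * logHeight₁ β) ^ 2⌉₊, fun n hn hpos γ hγ => ?_⟩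
  have hint : IsIntegral K γ := by
    have : IsIntegral K (γ ^ n) := by rw [hγ]; exact isIntegral_algebraMap
    exact this.of_pow hpos
  have : FiniteDimensional K (IntermediateField.adjoin K {γ}) :=
    IntermediateField.adjoin.finiteDimensional hint
  set D := Module.finrank K (IntermediateField.adjoin K {γ}) with hD
  have hDpos : 0 < D := Module.finrank_pos
  set g := IntermediateField.AdjoinSimple.gen K γ
  set δ : K := Algebra.norm K g with hδ
  have hg : g ^ n = algebraMap K (IntermediateField.adjoin K {γ}) β := by
    apply Subtype.ext
    simpa [g] using hγ
  have hpow : δ ^ n = β ^ D := norm_pow_root β g n hg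
  have hδ0 : δ ≠ 0 := by
    intro h
    rw [h, zero_pow hpos.ne'] at hpow
    exact pow_ne_zero _ hβ0 hpow.symm
  have hδru : ∀ k : ℕ, k ≠ 0 → δ ^ k ≠ 1 := by
    intro k hk h
    apply hβru (D * k) (Nat.mul_ne_zero hDpos.ne' hk)
    rw [pow_mul, ← hpow, pow_right_comm, h, one_pow]
  have h1 := hM δ hδ0 hδru
  have hh : (n : ℝ) * logHeight₁ δ = D * logHeight₁ β := by
    rw [← logHeight₁_pow, ← logHeight₁_pow, hpow]
  have hn' : (0 : ℝ) < n := by exact_mod_cast hpos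
  have h2 : (n : ℝ) < D * (M * logHeight₁ β) := by
    calc (n : ℝ) = n * 1 := (mul_one _).symm
      _ < n * (M * logHeight₁ δ) := by gcongr
      _ = M * (n * logHeight₁ δ) := by ring
      _ = D * (M * logHeight₁ β) := by rw [hh]; ring
  have h3 : M * logHeight₁ β ≤ Real.sqrt n :=
    Real.le_sqrt_of_sq_le ((Nat.le_ceil _).trans (by exact_mod_cast hn))
  have hs : 0 < Real.sqrt n := Real.sqrt_pos.mpr hn'
  have h4 : Real.sqrt n ≤ D := by
    have : Real.sqrt n * Real.sqrt n ≤ D * Real.sqrt n := by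
      rw [Real.mul_self_sqrt hn'.le]
      exact h2.le.trans (by gcongr)
    exact le_of_mul_le_mul_right this hs
  have hd : (1 : ℝ) ≤ (Module.finrank ℚ K : ℝ) := by
    exact_mod_cast Nat.succ_le_of_lt (Module.finrank_pos (R := ℚ) (M := K))
  exact (div_le_self hs.le hd).trans h4
end

section
/- Let p be a prime number and let L be a field equipped with a nonarchimedean (ultrametric) absolute value |·| whose restriction to ℚ is the p-adic absolute value normalized by |p| = 1/p. If ζ ∈ L is a root of unity with |ζ − 1| < 1, then the multiplicative order of ζ is a power of p. -/
theorem stmt_13 (p : ℕ) (hp : p.Prime)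
    (L : Type) [Field L] (w : AbsoluteValue L ℝ)
    (hna : IsNonarchimedean ⇑w) (hw : ∀ q : ℚ, w (q : L) = (padicNorm p q : ℝ))
    (ζ : L) (hζ : ∃ k : ℕ, 0 < k ∧ ζ ^ k = 1) (hdist : w (ζ - 1) < 1) :
    ∃ m : ℕ, orderOf ζ = p ^ m := by
  haveI : Fact p.Prime := ⟨hp⟩
  have hadd : ∀ x y : L, w x < 1 → w y < 1 → w (x + y) < 1 := fun x y hx hy =>
    lt_of_le_of_lt (hna x y) (max_lt hx hy)
  have hpow : ∀ x : L, w (x - 1) < 1 → ∀ j : ℕ, w (x ^ j - 1) < 1 := by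
    intro x hx j
    have hx1 : w x ≤ 1 := by
      have h := hna (x - 1) 1
      rw [sub_add_cancel, map_one] at h
      exact h.trans (max_le hx.le le_rfl)
    induction j with
    | zero => simp
    | succ j ih =>
      have e : x ^ (j + 1) - 1 = x ^ j * (x - 1) + (x ^ j - 1) := by ring
      rw [e]
      refine hadd _ _ ?_ ih
      rw [map_mul, map_pow]
      exact lt_of_le_of_lt
        (mul_le_of_le_one_left (w.nonneg _) (pow_le_one₀ (w.nonneg _) hx1)) hx
  have hsum : ∀ x : L, w (x - 1) < 1 → ∀ j : ℕ,
      w ((∑ i ∈ Finset.range j, x ^ i) - (j : L)) < 1 := by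
    intro x hx j
    induction j with
    | zero => simp
    | succ j ih =>
      have e : (∑ i ∈ Finset.range (j + 1), x ^ i) - ((j + 1 : ℕ) : L)
          = ((∑ i ∈ Finset.range j, x ^ i) - (j : L)) + (x ^ j - 1) := by
        rw [Finset.sum_range_succ]; push_cast; ring
      rw [e]
      exact hadd _ _ ih (hpow x hx j)
  have hn : orderOf ζ ≠ 0 := by
    obtain ⟨k, hk, h⟩ := hζ
    exact (orderOf_pos_iff.mpr (isOfFinOrder_iff_pow_eq_one.mpr ⟨k, hk, h⟩)).ne'
  obtain ⟨m, k, hk, hmk⟩ := Nat.exists_eq_pow_mul_and_not_dvd hn p hp.ne_one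
  refine ⟨m, ?_⟩
  have h1 : ζ ^ p ^ m = 1 := by
    by_contra hne
    have hηk : (ζ ^ p ^ m) ^ k = 1 := by
      rw [← pow_mul, ← hmk, pow_orderOf_eq_one]
    have hg := mul_geom_sum (ζ ^ p ^ m) k
    rw [hηk, sub_self] at hg
    have hz := (mul_eq_zero.mp hg).resolve_left (sub_ne_zero.mpr hne)
    have hlt := hsum _ (hpow ζ hdist (p ^ m)) k
    rw [hz, zero_sub, w.map_neg] at hlt
    have hwk := hw (k : ℚ)
    rw [Rat.cast_natCast, (padicNorm.nat_eq_one_iff k).mpr hk] at hwk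
    rw [hwk] at hlt
    simp at hlt
  exact Nat.dvd_antisymm (orderOf_dvd_of_pow_eq_one h1) ⟨k, hmk⟩
end

section
/- Let p be a prime number, let ε ∈ (0,1), and let L be a field equipped with a nonarchimedean absolute value |·| whose restriction to ℚ is the p-adic absolute value normalized by |p| = 1/p. Then the number of roots of unity ζ ∈ L satisfying |ζ − 1| ≤ 1 − ε is at most p·(log p)/ε. -/
lemma aux_pow_sub {L : Type} [Field L] (w : AbsoluteValue L ℝ) (hna : IsNonarchimedean ⇑w)
    (z : L) (hz : w z = 1) (i : ℕ) : w (z ^ i - 1) ≤ w (z - 1) := by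
  induction i with
  | zero => simp
  | succ i ih =>
    have h : z ^ (i+1) - 1 = z * (z ^ i - 1) + (z - 1) := by ring
    rw [h]
    refine (hna _ _).trans (max_le ?_ le_rfl)
    rw [map_mul, hz, one_mul]; exact ih

lemma aux_sum {L : Type} [Field L] (w : AbsoluteValue L ℝ) (hna : IsNonarchimedean ⇑w)
    (z : L) (hz : w z = 1) (m : ℕ) :
    w (∑ i ∈ Finset.range m, (z ^ i - 1)) ≤ w (z - 1) := by
  induction m with
  | zero => simp
  | succ m ih =>
    rw [Finset.sum_range_succ]
    exact (hna _ _).trans (max_le ih (aux_pow_sub w hna z hz m))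

lemma aux_w_one {L : Type} [Field L] (w : AbsoluteValue L ℝ) (z : L) (k : ℕ) (hk : 0 < k)
    (h : z ^ k = 1) : w z = 1 := by
  have h2 : w z ^ k = 1 := by rw [← map_pow, h, map_one]
  exact (pow_eq_one_iff_of_nonneg (w.nonneg z) hk.ne').1 h2

lemma aux_order (p : ℕ) (hp : p.Prime) (ε : ℝ) (hε0 : 0 < ε) (hε1 : ε < 1)
    (L : Type) [Field L] (w : AbsoluteValue L ℝ)
    (hna : IsNonarchimedean ⇑w) (hw : ∀ q : ℚ, w (q : L) = (padicNorm p q : ℝ))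
    (hR : 1 ≤ (p : ℝ) * Real.log p / ε)
    (z : L) (k : ℕ) (hk : 0 < k) (hz : z ^ k = 1) (hlt : w (z - 1) ≤ 1 - ε) :
    ∃ n : ℕ, z ^ (p ^ n) = 1 ∧ ((p ^ n : ℕ) : ℝ) ≤ (p : ℝ) * Real.log p / ε := by
  haveI := Fact.mk hp
  have hwz := aux_w_one w z k hk hz
  have hfin : 0 < orderOf z := orderOf_pos_iff.2 (isOfFinOrder_iff_pow_eq_one.2 ⟨k, hk, hz⟩)
  obtain ⟨n, m, hm, hnm⟩ := Nat.exists_eq_pow_mul_and_not_dvd hfin.ne' p hp.ne_one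
  have hzn : z ^ (p ^ n) = 1 := by
    by_contra hne
    have hwy : w (z ^ p ^ n) = 1 := by rw [map_pow, hwz, one_pow]
    have hy : w (z ^ p ^ n - 1) < 1 := by
      have := aux_pow_sub w hna z hwz (p ^ n)
      linarith
    have hym : (z ^ p ^ n) ^ m = 1 := by rw [← pow_mul, ← hnm, pow_orderOf_eq_one]
    have hg := geom_sum_eq hne m
    rw [hym, sub_self, zero_div] at hg
    have hs := aux_sum w hna _ hwy m
    rw [Finset.sum_sub_distrib, hg] at hs
    simp only [Finset.sum_const, Finset.card_range, nsmul_eq_mul, mul_one, zero_sub] at hs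
    have h1 := hw m
    rw [(padicNorm.nat_eq_one_iff (p := p) m).2 hm] at h1
    rw [AbsoluteValue.map_neg] at hs
    simp at h1
    linarith
  refine ⟨n, hzn, ?_⟩
  have hm1 : orderOf z = p ^ n :=
    Nat.dvd_antisymm (orderOf_dvd_of_pow_eq_one hzn) ⟨m, hnm⟩
  rcases n with _ | n
  · simpa using hR
  have hprim : IsPrimitiveRoot z (p ^ (n+1)) := hm1 ▸ IsPrimitiveRoot.orderOf z
  have hev : Polynomial.eval 1 (Polynomial.cyclotomic (p ^ (n+1)) L) = p :=
    Polynomial.eval_one_cyclotomic_prime_pow n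
  rw [Polynomial.cyclotomic_eq_prod_X_sub_primitiveRoots hprim, Polynomial.eval_prod] at hev
  have hwp : w (p : L) = (p : ℝ)⁻¹ := by
    have := hw p
    rw [padicNorm.padicNorm_p hp.one_lt] at this
    simpa using this
  have hle : (p : ℝ)⁻¹ ≤ (1 - ε) ^ (p ^ (n+1)).totient := by
    rw [← hwp, ← hev, map_prod, ← hprim.card_primitiveRoots]
    rw [← Finset.prod_const]
    refine Finset.prod_le_prod (fun i _ => w.nonneg _) fun i hi => ?_
    have hi2 := (mem_primitiveRoots (pow_pos hp.pos _)).1 hi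
    haveI : NeZero (p ^ (n+1)) := ⟨(pow_pos hp.pos _).ne'⟩
    obtain ⟨j, _, rfl⟩ := hprim.eq_pow_of_pow_eq_one hi2.pow_eq_one
    simp only [Polynomial.eval_sub, Polynomial.eval_X, Polynomial.eval_C]
    rw [AbsoluteValue.map_sub]
    exact (aux_pow_sub w hna z hwz j).trans hlt
  have hle2 : (p : ℝ)⁻¹ ≤ Real.exp (-((p ^ (n+1)).totient * ε)) := by
    refine hle.trans ?_
    rw [← mul_neg, Real.exp_nat_mul]
    have := Real.add_one_le_exp (-ε)
    exact pow_le_pow_left₀ (by linarith) (by linarith) _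
  have hp0 : (0:ℝ) < p := by exact_mod_cast hp.pos
  have h3 := Real.log_le_log (inv_pos.2 hp0) hle2
  rw [Real.log_exp, Real.log_inv] at h3
  have h4 : p ^ (n+1) ≤ p * (p ^ (n+1)).totient := by
    rw [Nat.totient_prime_pow_succ hp, pow_succ, mul_comm]
    have := hp.two_le
    exact Nat.mul_le_mul_left _ (Nat.le_mul_of_pos_right _ (by omega))
  have h5 : ((p ^ (n+1) : ℕ) : ℝ) ≤ p * ((p ^ (n+1)).totient : ℝ) := by exact_mod_cast h4
  rw [le_div_iff₀ hε0]
  calc _ ≤ p * ((p ^ (n+1)).totient : ℝ) * ε := by gcongr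
    _ = p * (((p ^ (n+1)).totient : ℝ) * ε) := by ring
    _ ≤ _ := by gcongr; linarith

/-!
Statement 14: over a field with a nonarchimedean absolute value restricting to the
`p`-adic absolute value on `ℚ` (normalized by `|p| = 1/p`), the number of roots of
unity `ζ` with `|ζ − 1| ≤ 1 − ε` is at most `p·(log p)/ε`.
-/

theorem stmt_14 (p : ℕ) (hp : p.Prime) (ε : ℝ) (hε0 : 0 < ε) (hε1 : ε < 1)
    (L : Type) [Field L] (w : AbsoluteValue L ℝ)
    (hna : IsNonarchimedean ⇑w) (hw : ∀ q : ℚ, w (q : L) = (padicNorm p q : ℝ)) :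
    {ζ : L | (∃ k : ℕ, 0 < k ∧ ζ ^ k = 1) ∧ w (ζ - 1) ≤ 1 - ε}.Finite ∧
      (({ζ : L | (∃ k : ℕ, 0 < k ∧ ζ ^ k = 1) ∧ w (ζ - 1) ≤ 1 - ε}.ncard : ℝ)) ≤
        (p : ℝ) * Real.log p / ε := by
  classical
  have hp2 : (2:ℝ) ≤ p := by exact_mod_cast hp.two_le
  have hR : 1 ≤ (p : ℝ) * Real.log p / ε := by
    rw [le_div_iff₀ hε0]
    have h1 := Real.log_le_log (by norm_num) hp2
    have h2 := Real.log_two_gt_d9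
    nlinarith
  set R := (p : ℝ) * Real.log p / ε with hRdef
  have hF : ⌊R⌋₊ ≠ 0 := by
    have := (Nat.one_le_floor_iff R).2 hR
    omega
  set N := Nat.log p ⌊R⌋₊ with hN
  have hNp : 0 < p ^ N := pow_pos hp.pos _
  have hsub : {ζ : L | (∃ k : ℕ, 0 < k ∧ ζ ^ k = 1) ∧ w (ζ - 1) ≤ 1 - ε} ⊆
      ((Polynomial.nthRoots (p ^ N) (1 : L)).toFinset : Set L) := by
    rintro z ⟨⟨k, hk, hz⟩, hlt⟩
    obtain ⟨n, hn, hle⟩ := aux_order p hp ε hε0 hε1 L w hna hw hR z k hk hz hlt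
    have hnN : n ≤ N := Nat.le_log_of_pow_le hp.one_lt (Nat.le_floor hle)
    simp only [Finset.mem_coe, Multiset.mem_toFinset]
    rw [Polynomial.mem_nthRoots hNp]
    obtain ⟨c, hc⟩ := pow_dvd_pow p hnN
    rw [hc, pow_mul, hn, one_pow]
  refine ⟨(Finset.finite_toSet _).subset hsub, ?_⟩
  have h1 := Set.ncard_le_ncard hsub (Finset.finite_toSet _)
  rw [Set.ncard_coe_finset] at h1
  have h2 := (Multiset.toFinset_card_le (Polynomial.nthRoots (p ^ N) (1 : L))).trans
    (Polynomial.card_nthRoots _ _)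
  have h3 : p ^ N ≤ ⌊R⌋₊ := Nat.pow_log_le_self p hF
  calc _ ≤ ((⌊R⌋₊ : ℕ) : ℝ) := by exact_mod_cast (h1.trans h2).trans h3
    _ ≤ R := Nat.floor_le (by linarith)
end

section
/- Let K be a number field, let v be a nonarchimedean place of K, and fix an embedding of ℚ̄ into an algebraic closure K̄_v of the completion K_v, equipped with the unique absolute value |·|_v extending that of K_v. Let d ≥ 2 be an integer, let β ∈ K be nonzero, and let α ∈ ℚ̄ satisfy α^{d^n} ≠ β for every integer n ≥ 0. Let (γ_m)_{m ≥ 1} be a sequence of pairwise distinct elements of ℚ̄ with γ_m^{d^{n_m}} = β for some integers n_m ≥ 0. Then lim_{m → ∞} (1/[K(γ_m):ℚ]) Σ_{σ} log |σ(γ_m) − α|_v = (1/[K:ℚ]) · log max(1, |α|_v), where the sum runs over all K-embeddings σ : K(γ_m) → K̄_v. -/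
open Polynomial Filter

namespace S15

section NA
variable {E : Type*} [Field E] (w : AbsoluteValue E ℝ)

lemma na_sum_le (hna : IsNonarchimedean ⇑w) {ι : Type*} (s : Finset ι) (f : ι → E) (c : ℝ) (hc : 0 ≤ c)
    (h : ∀ i ∈ s, w (f i) ≤ c) : w (∑ i ∈ s, f i) ≤ c := by
  classical
  induction s using Finset.induction_on with
  | empty => simpa using hc
  | insert a s ha ih =>
    rw [Finset.sum_insert ha]
    exact (hna _ _).trans (max_le (h a (by simp)) (ih fun i hi => h i (by simp [hi])))

lemma na_int_le (hna : IsNonarchimedean ⇑w) (n : ℤ) : w (n : E) ≤ 1 := by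
  have hnat : ∀ m : ℕ, w (m : E) ≤ 1 := by
    intro m
    induction m with
    | zero => simp
    | succ k ih =>
      push_cast
      exact (hna _ _).trans (max_le ih (by simp))
  obtain ⟨m, rfl | rfl⟩ := n.eq_nat_or_neg
  · simpa using hnat m
  · simpa using hnat m

lemma na_nat_le (hna : IsNonarchimedean ⇑w) (n : ℕ) : w (n : E) ≤ 1 := by
  simpa using na_int_le w hna n

lemma na_sub_le (hna : IsNonarchimedean ⇑w) (x y : E) : w (x - y) ≤ max (w x) (w y) := by
  have := hna x (-y)
  rwa [← sub_eq_add_neg, w.map_neg] at this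

lemma na_prod_le {ι : Type*} (s : Finset ι) (f : ι → E) (h : ∀ i ∈ s, w (f i) ≤ 1) :
    w (∏ i ∈ s, f i) ≤ 1 := by
  rw [map_prod]
  exact Finset.prod_le_one (fun i _ => w.nonneg _) h

lemma na_sign {ι : Type*} [Fintype ι] [DecidableEq ι] (σ : Equiv.Perm ι) :
    w (((Equiv.Perm.sign σ : ℤˣ) : ℤ) : E) = 1 := by
  rcases Int.units_eq_one_or (Equiv.Perm.sign σ) with h | h <;> simp [h]

lemma na_det_le (hna : IsNonarchimedean ⇑w) {ι : Type*} [Fintype ι] [DecidableEq ι]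
    (M : Matrix ι ι E) (h : ∀ i k, w (M i k) ≤ 1) : w M.det ≤ 1 := by
  rw [Matrix.det_apply']
  apply na_sum_le w hna _ _ _ zero_le_one
  intro σ _
  rw [map_mul, na_sign, one_mul]
  exact na_prod_le w _ _ fun i _ => h _ _

lemma na_prod_sub (hna : IsNonarchimedean ⇑w) {ι : Type*} (s : Finset ι) (f g : ι → E) (c : ℝ) (hc : 0 ≤ c)
    (hf : ∀ i ∈ s, w (f i) ≤ 1) (hg : ∀ i ∈ s, w (g i) ≤ 1) (h : ∀ i ∈ s, w (f i - g i) ≤ c) :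
    w (∏ i ∈ s, f i - ∏ i ∈ s, g i) ≤ c := by
  classical
  induction s using Finset.induction_on with
  | empty => simpa using hc
  | insert a s ha ih =>
    rw [Finset.prod_insert ha, Finset.prod_insert ha]
    have e : f a * ∏ i ∈ s, f i - g a * ∏ i ∈ s, g i
      = f a * (∏ i ∈ s, f i - ∏ i ∈ s, g i) + (f a - g a) * ∏ i ∈ s, g i := by ring
    rw [e]
    refine (hna _ _).trans (max_le ?_ ?_)
    · rw [map_mul]
      have := ih (fun i hi => hf i (by simp [hi])) (fun i hi => hg i (by simp [hi]))
        (fun i hi => h i (by simp [hi]))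
      calc _ ≤ 1 * c := mul_le_mul (hf a (by simp)) this (w.nonneg _) zero_le_one
        _ = c := one_mul c
    · rw [map_mul]
      have := na_prod_le w s g (fun i hi => hg i (by simp [hi]))
      calc _ ≤ c * 1 := mul_le_mul (h a (by simp)) this (w.nonneg _) hc
        _ = c := mul_one c

lemma na_det_sub (hna : IsNonarchimedean ⇑w) {ι : Type*} [Fintype ι] [DecidableEq ι]
    (M M' : Matrix ι ι E) (c : ℝ) (hc : 0 ≤ c) (h : ∀ i k, w (M i k) ≤ 1) (h' : ∀ i k, w (M' i k) ≤ 1)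
    (hs : ∀ i k, w (M i k - M' i k) ≤ c) : w (M.det - M'.det) ≤ c := by
  rw [Matrix.det_apply', Matrix.det_apply', ← Finset.sum_sub_distrib]
  apply na_sum_le w hna _ _ _ hc
  intro σ _
  rw [← mul_sub, map_mul, na_sign, one_mul]
  exact na_prod_sub w hna _ _ _ _ hc (fun i _ => h _ _) (fun i _ => h' _ _) (fun i _ => hs _ _)

lemma na_integral (hna : IsNonarchimedean ⇑w) (x : E) (hx : IsIntegral ℤ x) : w x ≤ 1 := by
  by_contra hlt
  push Not at hlt
  obtain ⟨f, hf, hfx⟩ := hx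
  have h0 : 0 < w x := by linarith
  rw [← Polynomial.aeval_def, Polynomial.aeval_eq_sum_range, Finset.sum_range_succ, hf.coeff_natDegree, one_smul] at hfx
  set n := f.natDegree
  have h1 : x ^ n = -∑ i ∈ Finset.range n, f.coeff i • x ^ i := by
    linear_combination hfx
  rcases Nat.eq_zero_or_pos n with hn | hn
  · rw [hn] at h1; simp at h1
  have h2 : w (x ^ n) ≤ (w x) ^ (n-1) := by
    rw [h1, w.map_neg]
    apply na_sum_le w hna _ _ _ (by positivity)
    intro i hi
    rw [zsmul_eq_mul, map_mul, map_pow]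
    have hi' : i ≤ n - 1 := by have := Finset.mem_range.1 hi; omega
    calc _ ≤ 1 * (w x) ^ i := mul_le_mul_of_nonneg_right (na_int_le w hna _) (by positivity)
      _ = (w x)^i := one_mul _
      _ ≤ _ := pow_le_pow_right₀ hlt.le hi'
  rw [map_pow] at h2
  have : (w x) ^ (n-1) < (w x)^n := pow_lt_pow_right₀ hlt (by omega)
  linarith

lemma na_nat_ge (hna : IsNonarchimedean ⇑w) (p : ℕ) (hp : p.Prime) (hw : w (p : E) = 1 / p)
    (m : ℕ) (hm : m ≠ 0) : 1 / (m : ℝ) ≤ w (m : E) := by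
  obtain ⟨k, m', hm', rfl⟩ := Nat.exists_eq_pow_mul_and_not_dvd hm p hp.ne_one
  have hcop : Nat.Coprime p m' := (Nat.Prime.coprime_iff_not_dvd hp).2 hm'
  have hp0 : (0:ℝ) < p := by exact_mod_cast hp.pos
  have hp1 : (1:ℝ) < p := by exact_mod_cast hp.one_lt
  have hwp : w (p : E) < 1 := by rw [hw, div_lt_one hp0]; exact hp1
  have h1 : w (m' : E) = 1 := by
    apply le_antisymm (na_nat_le w hna _)
    by_contra hlt
    push Not at hlt
    have hb := Nat.gcd_eq_gcd_ab p m'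
    rw [hcop.gcd_eq_one] at hb
    have hb' : (1 : E) = (p : E) * (p.gcdA m' : ℤ) + (m' : E) * (p.gcdB m' : ℤ) := by
      exact_mod_cast congrArg (Int.cast : ℤ → E) hb
    have : w (1 : E) < 1 := by
      rw [hb']
      refine (hna _ _).trans_lt (max_lt ?_ ?_)
      · rw [map_mul]
        calc _ ≤ w (p : E) * 1 := mul_le_mul_of_nonneg_left (na_int_le w hna _) (w.nonneg _)
          _ < 1 := by linarith
      · rw [map_mul]
        calc _ ≤ w (m' : E) * 1 := mul_le_mul_of_nonneg_left (na_int_le w hna _) (w.nonneg _)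
          _ < 1 := by linarith
    simp at this
  have hm0 : 1 ≤ (m' : ℝ) := by
    have : m' ≠ 0 := by rintro rfl; simp at hm'
    exact_mod_cast Nat.one_le_iff_ne_zero.2 this
  push_cast
  rw [map_mul, map_pow, h1, hw, mul_one, one_div, one_div, inv_pow]
  apply inv_anti₀ (by positivity)
  nlinarith [pow_pos hp0 k]

/-- Liouville-type inequality. -/
lemma liouville [NumberField E] (hna : IsNonarchimedean ⇑w) (p : ℕ) (hp : p.Prime) (hw : w (p : E) = 1 / p)
    (x : E) (hx : IsIntegral ℤ x) (hx0 : x ≠ 0) (H : ℝ) (hH : ∀ φ : E →+* ℂ, ‖φ x‖ ≤ H) :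
    1 / H ^ (Module.finrank ℚ E) ≤ w x := by
  obtain ⟨y, rfl⟩ : ∃ y : NumberField.RingOfIntegers E, algebraMap _ E y = x := ⟨⟨x, hx⟩, rfl⟩
  have hy0 : y ≠ 0 := by rintro rfl; simp at hx0
  set m := Ideal.absNorm (Ideal.span {y}) with hmdef
  have hm0 : m ≠ 0 := by
    rw [hmdef, Ne, Ideal.absNorm_eq_zero_iff, Ideal.span_singleton_eq_bot]; exact hy0
  have hmem : (m : NumberField.RingOfIntegers E) ∈ Ideal.span {y} := Ideal.absNorm_mem _
  obtain ⟨z, hz⟩ := Ideal.mem_span_singleton'.1 hmem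
  have hwm : w (m : E) ≤ w (algebraMap _ E y) := by
    have : (m : E) = algebraMap _ E z * algebraMap _ E y := by
      rw [← map_mul, hz]; simp
    rw [this, map_mul]
    calc _ ≤ 1 * w (algebraMap _ E y) :=
          mul_le_mul_of_nonneg_right (na_integral w hna _ z.isIntegral_coe) (w.nonneg _)
      _ = _ := one_mul _
  have hmH : (m : ℝ) ≤ H ^ Module.finrank ℚ E := by
    have h1 : (m : ℝ) = ‖((Algebra.norm ℚ (algebraMap _ E y) : ℚ) : ℂ)‖ := by
      rw [hmdef, Ideal.absNorm_span_singleton, ← Algebra.coe_norm_int]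
      simp [Nat.cast_natAbs]
    have h2 := Algebra.norm_eq_prod_embeddings ℚ ℂ (algebraMap _ E y)
    rw [h1]
    rw [eq_ratCast] at h2
    rw [h2, norm_prod]
    calc _ ≤ ∏ σ : E →ₐ[ℚ] ℂ, H := Finset.prod_le_prod (fun _ _ => norm_nonneg _) (fun σ _ => hH σ.toRingHom)
      _ = _ := by rw [Finset.prod_const, Finset.card_univ, AlgHom.card]
  calc _ ≤ 1 / (m : ℝ) := one_div_le_one_div_of_le (by positivity) hmH
    _ ≤ w (m : E) := na_nat_ge w hna p hp hw m hm0
    _ ≤ _ := hwm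

end NA

lemma sum_distinct (s : Finset ℕ) : s.card * (s.card - 1) ≤ 2 * ∑ i ∈ s, i := by
  induction s using Finset.induction_on_max with
  | empty => simp
  | insert a s h ih =>
    have ha : a ∉ s := fun h' => lt_irrefl _ (h a h')
    rw [Finset.card_insert_of_notMem ha, Finset.sum_insert ha]
    have hc : s.card ≤ a := by
      have : s ⊆ Finset.range a := fun x hx => Finset.mem_range.2 (h x hx)
      simpa using Finset.card_le_card this
    rcases Nat.eq_zero_or_pos s.card with h0 | h0
    · simp [h0]
    · obtain ⟨c, hc'⟩ : ∃ c, s.card = c + 1 := ⟨s.card - 1, by omega⟩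
      rw [hc'] at hc ih ⊢
      simp only [Nat.add_sub_cancel] at ih ⊢
      nlinarith

lemma exists_rows {F : Type*} [Field F] {m n : Type*} [Fintype n] [DecidableEq n] [Fintype m]
    (M : Matrix m n F) (h : ∀ v : n → F, (∀ i, ∑ k, M i k * v k = 0) → v = 0) :
    ∃ g : n → m, (M.submatrix g id).det ≠ 0 := by
  classical
  obtain ⟨κ, a, ha, hsp, hli⟩ := exists_linearIndependent' F (fun i : m => M i)
  have hr : M.rank = Fintype.card n := by
    have hinj : Function.Injective M.mulVecLin := by
      rw [injective_iff_map_eq_zero]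
      intro v hv
      apply h
      intro i
      exact congrFun hv i
    rw [Matrix.rank, LinearMap.finrank_range_of_inj hinj]; simp
  have : Fintype κ := Fintype.ofInjective a ha
  have hcard : Fintype.card κ = Fintype.card n := by
    rw [← hr, Matrix.rank_eq_finrank_span_row, ← finrank_span_eq_card hli, hsp]; rfl
  let e : n ≃ κ := (Fintype.equivOfCardEq hcard).symm
  refine ⟨a ∘ e, ?_⟩
  have hli2 : LinearIndependent F (M.submatrix (a ∘ e) id).row := hli.comp e e.injective
  rw [Matrix.linearIndependent_rows_iff_isUnit, Matrix.isUnit_iff_isUnit_det] at hli2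
  exact hli2.ne_zero

end S15

namespace S15

section Upper
variable {E : Type*} [Field E] (w : AbsoluteValue E ℝ)

lemma expand (hna : IsNonarchimedean ⇑w) (x : E) (ρ : ℝ) (hρ0 : 0 ≤ ρ) (hρ1 : ρ ≤ 1) (hx : w x ≤ ρ) (a : ℕ) :
    ∃ g : ℕ → E, (∀ j, w (g j) ≤ ρ ^ (j - a)) ∧ ∀ k J : ℕ, k < J →
      (k : E) ^ a * (1 + x) ^ k = ∑ j ∈ Finset.range J, (k.choose j : E) * g j := by
  induction a with
  | zero =>
    refine ⟨fun j => x ^ j, fun j => ?_, fun k J hk => ?_⟩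
    · rw [map_pow, Nat.sub_zero]; exact pow_le_pow_left₀ (w.nonneg _) hx _
    · rw [pow_zero, one_mul, add_comm, add_pow]
      have : Finset.range (k+1) ⊆ Finset.range J := Finset.range_subset_range.2 hk
      rw [← Finset.sum_subset this]
      · apply Finset.sum_congr rfl; intro j _; simp [mul_comm]
      · intro j _ hj
        rw [Nat.choose_eq_zero_of_lt (by simpa using hj)]; simp
  | succ a ih =>
    obtain ⟨g, hg, hs⟩ := ih
    refine ⟨fun j => (j : E) * g j + (j : E) * g (j - 1), fun j => ?_, fun k J hk => ?_⟩
    · refine (hna _ _).trans (max_le ?_ ?_)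
      · rw [map_mul]
        calc _ ≤ 1 * ρ ^ (j - a) := mul_le_mul (na_nat_le w hna _) (hg j) (w.nonneg _) zero_le_one
          _ = ρ ^ (j - a) := one_mul _
          _ ≤ _ := pow_le_pow_of_le_one hρ0 hρ1 (by omega)
      · rw [map_mul]
        calc _ ≤ 1 * ρ ^ (j - 1 - a) := mul_le_mul (na_nat_le w hna _) (hg _) (w.nonneg _) zero_le_one
          _ = ρ ^ (j - 1 - a) := one_mul _
          _ ≤ _ := pow_le_pow_of_le_one hρ0 hρ1 (by omega)
    · have h1 : (k : E) ^ (a+1) * (1 + x) ^ k = k * ((k : E) ^ a * (1 + x) ^ k) := by ring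
      rw [h1, hs k J hk, Finset.mul_sum]
      have h2 : ∀ j, (k : E) * ((k.choose j : E) * g j) =
          (k.choose j : E) * (j * g j) + (k.choose (j+1) : E) * (((j+1 : ℕ) : E) * g (j + 1 - 1)) := by
        intro j
        have h3 : k * k.choose j = k.choose j * j + k.choose (j+1) * (j+1) := by
          rw [Nat.choose_succ_right_eq]
          rcases le_or_gt j k with h | h
          · rw [← mul_add, Nat.add_sub_cancel' h, mul_comm]
          · simp [Nat.choose_eq_zero_of_lt h]
        have h4 : (k : E) * k.choose j = k.choose j * j + k.choose (j+1) * ((j+1 : ℕ) : E) := by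
          exact_mod_cast congrArg (Nat.cast : ℕ → E) h3
        rw [← mul_assoc, h4, Nat.add_sub_cancel]; ring
      simp_rw [h2, mul_add]
      rw [Finset.sum_add_distrib, Finset.sum_add_distrib]
      congr 1
      have h5 := Finset.sum_range_succ' (fun j => (k.choose j : E) * ((j : E) * g (j - 1))) J
      rw [Finset.sum_range_succ, Nat.choose_eq_zero_of_lt hk] at h5
      simp only [Nat.cast_zero, zero_mul, add_zero, mul_zero] at h5
      exact h5.symm

lemma det_upper (hna : IsNonarchimedean ⇑w) (ρ : ℝ) (hρ0 : 0 ≤ ρ) (hρ1 : ρ ≤ 1)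
    {ι : Type*} [Fintype ι] [DecidableEq ι] (A J T : ℕ) (k : ι → ℕ) (hk : ∀ i, k i < J)
    (M : Matrix ι ι E) (g : ι → ℕ → E)
    (hg : ∀ c j, w (g c j) ≤ ρ ^ (j - A))
    (hM : ∀ i c, M i c = ∑ j ∈ Finset.range J, ((k i).choose j : E) * g c j)
    (hT : 2 * T + 2 * A * Fintype.card ι ≤ Fintype.card ι * (Fintype.card ι - 1)) :
    w M.det ≤ ρ ^ T := by
  classical
  have hMt : M.transpose = fun c => ∑ j ∈ Finset.range J, g c j • (fun i => ((k i).choose j : E)) := by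
    ext c i
    rw [Matrix.transpose_apply, hM, Finset.sum_apply]
    apply Finset.sum_congr rfl; intro j _; simp [mul_comm]
  have hdet : M.det = ∑ f ∈ Fintype.piFinset (fun _ : ι => Finset.range J),
      (∏ c, g c (f c)) * Matrix.det (Matrix.of fun c i => ((k i).choose (f c) : E)) := by
    rw [← Matrix.det_transpose, hMt]
    have := (Matrix.detRowAlternating (n := ι) (R := E)).toMultilinearMap.map_sum_finset
      (fun c j => g c j • (fun i => ((k i).choose j : E))) (fun _ => Finset.range J)
    refine this.trans ?_
    apply Finset.sum_congr rfl
    intro f _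
    rw [MultilinearMap.map_smul_univ, smul_eq_mul]
    rfl
  rw [hdet]
  apply na_sum_le w hna _ _ _ (by positivity)
  intro f _
  by_cases hf : Function.Injective f
  · rw [map_mul]
    have h1 : w (Matrix.det (Matrix.of fun c i => ((k i).choose (f c) : E))) ≤ 1 :=
      na_det_le w hna _ fun i c => na_nat_le w hna _
    have h2 : w (∏ c, g c (f c)) ≤ ρ ^ T := by
      rw [map_prod]
      calc _ ≤ ∏ c, ρ ^ (f c - A) := Finset.prod_le_prod (fun _ _ => w.nonneg _) (fun c _ => hg _ _)
        _ = ρ ^ (∑ c, (f c - A)) := Finset.prod_pow_eq_pow_sum _ _ _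
        _ ≤ ρ ^ T := by
          apply pow_le_pow_of_le_one hρ0 hρ1
          have h3 := sum_distinct (Finset.univ.image f)
          rw [Finset.card_image_of_injective _ hf, Finset.sum_image (fun a _ b _ h => hf h), Finset.card_univ] at h3
          have h4 : ∑ c, f c ≤ ∑ c, (f c - A) + Fintype.card ι * A := by
            calc _ ≤ ∑ c, ((f c - A) + A) := Finset.sum_le_sum (fun c _ => by omega)
              _ = _ := by rw [Finset.sum_add_distrib]; simp
          nlinarith
    calc _ ≤ ρ ^ T * 1 := mul_le_mul h2 h1 (w.nonneg _) (by positivity)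
      _ = _ := mul_one _
  · rw [Function.Injective] at hf
    push Not at hf
    obtain ⟨c, c', hcc, hne⟩ := hf
    rw [Matrix.det_zero_of_row_eq hne (by ext i; simp [hcc])]
    simp; positivity

end Upper

section Zero
variable {F : Type*} [Field F]

lemma coeff_prod_le {ι : Type*} (s : Finset ι) (f : ι → F[X]) (n : ι → ℕ)
    (h : ∀ i ∈ s, (f i).natDegree ≤ n i) :
    (∏ i ∈ s, f i).coeff (∑ i ∈ s, n i) = ∏ i ∈ s, (f i).coeff (n i) := by
  classical
  induction s using Finset.induction_on with
  | empty => simp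
  | insert a s ha ih =>
    rw [Finset.prod_insert ha, Finset.prod_insert ha, Finset.sum_insert ha,
      Polynomial.coeff_mul_add_eq_of_natDegree_le (h a (by simp)), ih fun i hi => h i (by simp [hi])]
    refine (natDegree_prod_le _ _).trans (Finset.sum_le_sum fun i hi => h i (by simp [hi]))

lemma sum_T {B : ℕ} (p : Fin B → Prop) [DecidablePred p] (f : Fin B → F) (h : ∀ b, ¬ p b → f b = 0) :
    ∑ t : {b // p b}, f t.1 = ∑ b, f b := by
  rw [← Finset.sum_subtype (Finset.univ.filter p) (by simp) f]
  apply Finset.sum_subset (Finset.filter_subset _ _)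
  intro b _ hb
  exact h b (by simpa using hb)

lemma zero_est [CharZero F] (α β : F) (hα0 : α ≠ 0) (hα : ∀ n : ℕ, 0 < n → α ^ n ≠ 1) (hβ0 : β ≠ 0)
    (A B R2 S N : ℕ) (hN : R2 ≤ N) (hRS : A * B ≤ R2 * S) (hA : 0 < A)
    (c : Fin A × Fin B → F)
    (hc : ∀ r s : ℕ, r < R2 + B → s < S →
      ∑ q : Fin A × Fin B, (((r + s * N : ℕ) : F) ^ (q.1 : ℕ) * (α ^ r * β ^ s) ^ (q.2 : ℕ)) * c q = 0) :
    c = 0 := by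
  classical
  have hαinj : ∀ i k : ℕ, α ^ i = α ^ k → i = k := by
    have key : ∀ i k : ℕ, i < k → α ^ i ≠ α ^ k := by
      intro i k hik h
      apply hα (k - i) (by omega)
      have : α ^ k = α ^ i * α ^ (k - i) := by rw [← pow_add]; congr 1; omega
      rw [this] at h
      exact (mul_left_cancel₀ (pow_ne_zero i hα0) (by rw [mul_one]; exact h)).symm
    intro i k h
    rcases lt_trichotomy i k with h' | h' | h'
    · exact (key _ _ h' h).elim
    · exact h'
    · exact (key _ _ h' h.symm).elim
  let P : Fin B → F[X] := fun b => ∑ a : Fin A, C (c (a, b)) * X ^ (a : ℕ)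
  have hPdeg : ∀ b, (P b).natDegree ≤ A - 1 := by
    intro b
    apply Polynomial.natDegree_sum_le_of_forall_le
    intro a _
    refine (natDegree_C_mul_X_pow_le _ _).trans ?_
    have := a.2; omega
  have hPcoeff : ∀ b (a : Fin A), (P b).coeff a = c (a, b) := by
    intro b a
    simp only [P, finsetSum_coeff, coeff_C_mul, coeff_X_pow]
    rw [Finset.sum_eq_single a]
    · simp
    · intro a' _ hne
      rw [if_neg, mul_zero]
      intro h; exact hne (Fin.ext h.symm)
    · simp
  by_contra hne
  let T := {b : Fin B // P b ≠ 0}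
  have hTne : Nonempty T := by
    by_contra hT
    apply hne
    ext ⟨a, b⟩
    rw [← hPcoeff]
    have : P b = 0 := by
      by_contra h; exact hT ⟨⟨b, h⟩⟩
    simp [this]
  -- select translates
  obtain ⟨g, hg⟩ := exists_rows (Matrix.of fun (i : Fin B) (t : T) => (α ^ (i : ℕ)) ^ (t.1 : ℕ)) (by
    intro v hv
    have hvan : (Matrix.vandermonde (fun i : Fin B => α ^ (i : ℕ))).det ≠ 0 := by
      rw [Matrix.det_vandermonde_ne_zero_iff]
      intro i k h
      exact Fin.ext (hαinj _ _ h)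
    let v' : Fin B → F := fun b => if h : P b ≠ 0 then v ⟨b, h⟩ else 0
    have hv' : (Matrix.vandermonde (fun i : Fin B => α ^ (i : ℕ))).mulVec v' = 0 := by
      ext i
      have h1 := hv i
      simp only [Matrix.mulVec, dotProduct, Matrix.vandermonde_apply, Pi.zero_apply]
      rw [← h1]
      rw [← sum_T (fun b => P b ≠ 0)]
      · apply Finset.sum_congr rfl
        rintro ⟨b, hb⟩ _
        simp [v', hb]
      · intro b hb
        simp only [v']
        rw [dif_neg hb, mul_zero]
    have := Matrix.eq_zero_of_mulVec_eq_zero hvan hv'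
    ext t
    have h2 := congrFun this t.1
    simpa [v', t.2] using h2)
  let D : Matrix T T F[X] := Matrix.of fun i t => taylor ((g i : ℕ) : F) (P t.1) * C ((α ^ (g i : ℕ)) ^ (t.1 : ℕ))
  have hDdeg : D.det.natDegree ≤ Fintype.card T * (A - 1) := by
    rw [Matrix.det_apply]
    apply Polynomial.natDegree_sum_le_of_forall_le
    intro σ _
    refine (natDegree_smul_le _ _).trans ((natDegree_prod_le _ _).trans ?_)
    calc _ ≤ ∑ t : T, (A - 1) := Finset.sum_le_sum fun t _ =>
          ((natDegree_mul_C_le _ _).trans ((natDegree_taylor _ _).le.trans (hPdeg _)))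
      _ = _ := by simp
  have hDcoeff : D.det.coeff (∑ t : T, (P t.1).natDegree) =
      (∏ t : T, (P t.1).leadingCoeff) * ((Matrix.of fun (i : Fin B) (t : T) => (α ^ (i : ℕ)) ^ (t.1 : ℕ)).submatrix g id).det := by
    rw [Matrix.det_apply', Matrix.det_apply', finsetSum_coeff, Finset.mul_sum]
    apply Finset.sum_congr rfl
    intro σ _
    have e1 : (((Equiv.Perm.sign σ : ℤˣ) : ℤ) : F[X]) = C (((Equiv.Perm.sign σ : ℤˣ) : ℤ) : F) := by simp
    rw [e1, coeff_C_mul, coeff_prod_le]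
    · have : ∀ t : T, (D (σ t) t).coeff (P t.1).natDegree =
          (P t.1).leadingCoeff * (α ^ (g (σ t) : ℕ)) ^ (t.1 : ℕ) := by
        intro t
        simp only [D, Matrix.of_apply, coeff_mul_C, coeff_taylor_natDegree]
      simp_rw [this]
      rw [Finset.prod_mul_distrib]
      simp only [Matrix.submatrix_apply, Matrix.of_apply, id]
      ring
    · intro t _
      exact (natDegree_mul_C_le _ _).trans (natDegree_taylor _ _).le
  have hD0 : D.det ≠ 0 := by
    intro h
    rw [h, coeff_zero] at hDcoeff
    have := hDcoeff.symm
    rw [mul_eq_zero] at this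
    rcases this with h' | h'
    · rw [Finset.prod_eq_zero_iff] at h'
      obtain ⟨t, _, ht⟩ := h'
      exact t.2 (leadingCoeff_eq_zero.1 ht)
    · exact hg h'
  apply hD0
  refine Polynomial.eq_zero_of_natDegree_lt_card_of_eval_eq_zero (ι := Fin R2 × Fin S) _
    (f := fun q => (((q.1 : ℕ) + (q.2 : ℕ) * N : ℕ) : F)) ?_ ?_ ?_
  · rintro ⟨r, s⟩ ⟨r', s'⟩ h
    simp only [Nat.cast_inj] at h
    have hr := r.2.trans_le hN
    have hr' := r'.2.trans_le hN
    have e1 := congrArg (· % N) h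
    have e2 := congrArg (· / N) h
    simp only [Nat.add_mul_mod_self_right, Nat.mod_eq_of_lt hr, Nat.mod_eq_of_lt hr'] at e1
    have hN0 : 0 < N := by omega
    simp only [Nat.add_mul_div_right _ _ hN0, Nat.div_eq_of_lt hr, Nat.div_eq_of_lt hr', zero_add] at e2
    exact Prod.ext (Fin.ext e1) (Fin.ext e2)
  · rintro ⟨r, s⟩
    set x : F := (((r : ℕ) + (s : ℕ) * N : ℕ) : F) with hx
    have hev : D.det.eval x = ((evalRingHom x).mapMatrix D).det := by
      rw [← RingHom.map_det]; rfl
    show D.det.eval x = 0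
    rw [hev]
    rw [← Matrix.exists_mulVec_eq_zero_iff]
    refine ⟨fun t => (α ^ (r : ℕ) * β ^ (s : ℕ)) ^ (t.1 : ℕ), ?_, ?_⟩
    · intro h
      obtain ⟨t⟩ := hTne
      have := congrFun h t
      simp only [Pi.zero_apply] at this
      exact pow_ne_zero _ (mul_ne_zero (pow_ne_zero _ hα0) (pow_ne_zero _ hβ0)) this
    · ext i
      simp only [Matrix.mulVec, dotProduct, RingHom.mapMatrix_apply, Matrix.map_apply, D, Matrix.of_apply,
        coe_evalRingHom, eval_mul, eval_C, Pi.zero_apply, taylor_eval]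
      have h1 := hc (r + g i) s (by have := r.2; have := (g i).2; omega) s.2
      rw [Fintype.sum_prod_type_right] at h1
      rw [← h1, ← sum_T (fun b => P b ≠ 0)]
      · apply Finset.sum_congr rfl
        rintro ⟨b, hb⟩ _
        have h2 : eval (x + ((g i : ℕ) : F)) (P b) = ∑ a : Fin A, c (a, b) * (((r : ℕ) + (g i : ℕ) + (s : ℕ) * N : ℕ) : F) ^ (a : ℕ) := by
          simp only [P, eval_finsetSum, eval_mul, eval_C, eval_pow, eval_X]
          apply Finset.sum_congr rfl
          intro a _
          congr 2
          rw [hx]; push_cast; ring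
        simp only [h2]
        rw [Finset.sum_mul, Finset.sum_mul]
        apply Finset.sum_congr rfl
        intro a _
        rw [pow_add α]
        simp only [mul_pow]
        ring
      · intro b hb
        have hb' : P b = 0 := by simpa using hb
        apply Finset.sum_eq_zero
        intro a _
        rw [← hPcoeff, hb', coeff_zero, mul_zero]
  · rw [Fintype.card_prod, Fintype.card_fin, Fintype.card_fin]
    refine lt_of_le_of_lt hDdeg (lt_of_lt_of_le ?_ hRS)
    have h1 : Fintype.card T ≤ B := by
      have := Fintype.card_subtype_le (fun b => P b ≠ 0)
      rwa [Fintype.card_fin] at this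
    have h2 : 0 < Fintype.card T := Fintype.card_pos
    calc Fintype.card T * (A-1) < Fintype.card T * A := Nat.mul_lt_mul_of_pos_left (by omega) h2
      _ ≤ _ := by rw [mul_comm]; exact Nat.mul_le_mul_left _ h1
end Zero
end S15

namespace S15

section Key
variable {E : Type*} [Field E] (w : AbsoluteValue E ℝ)

lemma na_pow_sub (hna : IsNonarchimedean ⇑w) (x y : E) (n : ℕ) (hx : w x ≤ 1) (hy : w y ≤ 1) :
    w (x ^ n - y ^ n) ≤ w (x - y) := by
  have := na_prod_sub w hna (Finset.range n) (fun _ => x) (fun _ => y) (w (x - y)) (w.nonneg _)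
    (fun _ _ => hx) (fun _ _ => hy) (fun _ _ => le_rfl)
  simpa using this

lemma key [NumberField E] (hna : IsNonarchimedean ⇑w) (p : ℕ) (hp : p.Prime) (hw : w (p : E) = 1 / p)
    (α β : E) (hα1 : w α = 1) (hβ1 : w β = 1) (hα : ∀ n : ℕ, 0 < n → α ^ n ≠ 1)
    (ρ : ℝ) (hρ0 : 0 ≤ ρ) (hρ1 : ρ ≤ 1) (hρ : w (α - 1) ≤ ρ)
    (δ : ℕ) (hδ : 0 < δ) (hδα : IsIntegral ℤ ((δ : E) * α)) (hδβ : IsIntegral ℤ ((δ : E) * β))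
    (H : ℝ) (hH1 : 1 ≤ H) (hHα : ∀ φ : E →+* ℂ, ‖φ α‖ ≤ H) (hHβ : ∀ φ : E →+* ℂ, ‖φ β‖ ≤ H)
    (A B R2 S N T : ℕ) (hN : R2 ≤ N) (hRS : A * B ≤ R2 * S) (hA : 0 < A)
    (hT : 2 * T + 2 * A * (A * B) ≤ (A * B) * (A * B - 1)) :
    1 / ((((A * B).factorial : ℝ) * ((δ * H) ^ (B * (R2 + B + S)) * ((R2 + B + S * N : ℕ) : ℝ) ^ A) ^ (A * B)))
      ^ (Module.finrank ℚ E) ≤ max (w (α ^ N - β)) (ρ ^ T) := by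
  classical
  have hα0 : α ≠ 0 := by rintro rfl; simp at hα1
  have hβ0 : β ≠ 0 := by rintro rfl; simp at hβ1
  obtain ⟨g, hg⟩ := exists_rows (Matrix.of fun (i : Fin (R2 + B) × Fin S) (q : Fin A × Fin B) =>
    (((i.1 : ℕ) + (i.2 : ℕ) * N : ℕ) : E) ^ (q.1 : ℕ) * (α ^ (i.1 : ℕ) * β ^ (i.2 : ℕ)) ^ (q.2 : ℕ)) (by
      intro c hc
      apply zero_est α β hα0 hα hβ0 A B R2 S N hN hRS hA c
      intro r s hr hs
      exact hc (⟨r, hr⟩, ⟨s, hs⟩))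
  set M := (Matrix.of fun (i : Fin (R2 + B) × Fin S) (q : Fin A × Fin B) =>
    (((i.1 : ℕ) + (i.2 : ℕ) * N : ℕ) : E) ^ (q.1 : ℕ) * (α ^ (i.1 : ℕ) * β ^ (i.2 : ℕ)) ^ (q.2 : ℕ)).submatrix g id with hMdef
  have hMe : ∀ i q, M i q = (((g i).1 + (g i).2 * N : ℕ) : E) ^ (q.1 : ℕ) *
      (α ^ ((g i).1 : ℕ) * β ^ ((g i).2 : ℕ)) ^ (q.2 : ℕ) := fun i q => rfl
  have hcard : Fintype.card (Fin A × Fin B) = A * B := by simp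
  set e := B * (R2 + B + S) with he
  -- exponent bookkeeping
  have hexp : ∀ (i q : Fin A × Fin B), (((g i).1 : ℕ) + (g i).2) * (q.2 : ℕ) ≤ e := by
    intro i q
    rw [he, mul_comm]
    have h1 := (g i).1.2
    have h2 := (g i).2.2
    exact Nat.mul_le_mul q.2.2.le (by omega)
  -- lower bound
  have hlow : 1 / ((((A * B).factorial : ℝ) * ((δ * H) ^ e * ((R2 + B + S * N : ℕ) : ℝ) ^ A) ^ (A * B)))
      ^ (Module.finrank ℚ E) ≤ w M.det := by
    have hδ0 : (δ : E) ≠ 0 := by exact_mod_cast hδ.ne'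
    have h1 : IsIntegral ℤ (((δ : E) ^ e) • M).det := by
      apply IsIntegral.det
      intro i q
      have h2 : (((δ : E) ^ e) • M) i q = (δ : E) ^ (e - (((g i).1 : ℕ) + (g i).2) * (q.2 : ℕ)) *
          ((((g i).1 + (g i).2 * N : ℕ) : E) ^ (q.1 : ℕ) *
            (((δ : E) * α) ^ ((g i).1 : ℕ) * ((δ : E) * β) ^ ((g i).2 : ℕ)) ^ (q.2 : ℕ)) := by
        rw [Matrix.smul_apply, smul_eq_mul, hMe]
        have : (δ : E) ^ e = (δ : E) ^ (e - (((g i).1 : ℕ) + (g i).2) * (q.2 : ℕ)) *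
          ((δ : E) ^ ((g i).1 : ℕ) * (δ : E) ^ ((g i).2 : ℕ)) ^ (q.2 : ℕ) := by
          rw [← pow_add, ← pow_mul, ← pow_add, Nat.sub_add_cancel (hexp i q)]
        rw [this]
        simp only [mul_pow]
        ring
      rw [h2]
      have hnat : ∀ n : ℕ, IsIntegral ℤ (n : E) := fun n => by
        have := isIntegral_algebraMap (R := ℤ) (A := E) (x := (n : ℤ))
        simpa using this
      exact ((hnat δ).pow _).mul (((hnat _).pow _).mul (((hδα.pow _).mul (hδβ.pow _)).pow _))
    have h3 : (((δ : E) ^ e) • M).det ≠ 0 := by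
      rw [Matrix.det_smul]
      exact mul_ne_zero (pow_ne_zero _ (pow_ne_zero _ hδ0)) hg
    have h4 := liouville w hna p hp hw _ h1 h3
      (((A * B).factorial : ℝ) * ((δ * H) ^ e * ((R2 + B + S * N : ℕ) : ℝ) ^ A) ^ (A * B)) (by
        intro φ
        rw [RingHom.map_det]
        have h5 := Matrix.det_le (A := φ.mapMatrix (((δ : E) ^ e) • M)) (abv := NormedField.toAbsoluteValue ℂ)
          (x := (δ * H) ^ e * ((R2 + B + S * N : ℕ) : ℝ) ^ A) (by
            intro i q
            show ‖φ ((((δ : E) ^ e) • M) i q)‖ ≤ _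
            rw [Matrix.smul_apply, smul_eq_mul, hMe]
            simp only [map_mul, map_pow, norm_mul, norm_pow, map_natCast, Complex.norm_natCast]
            have hk : (((g i).1 + (g i).2 * N : ℕ) : ℝ) ^ (q.1 : ℕ) ≤ ((R2 + B + S * N : ℕ) : ℝ) ^ A := by
              have hle : ((g i).1 + (g i).2 * N : ℕ) ≤ R2 + B + S * N :=
                Nat.add_le_add (g i).1.2.le (Nat.mul_le_mul_right _ (g i).2.2.le)
              have h0 : 0 < R2 + B + S * N := by have := (g i).1.2; omega
              exact_mod_cast (Nat.pow_le_pow_left hle _).trans (Nat.pow_le_pow_right h0 q.1.2.le)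
            have hab : (‖φ α‖ ^ ((g i).1 : ℕ) * ‖φ β‖ ^ ((g i).2 : ℕ)) ^ (q.2 : ℕ) ≤ H ^ e := by
              calc _ ≤ (H ^ ((g i).1 : ℕ) * H ^ ((g i).2 : ℕ)) ^ (q.2 : ℕ) := by
                    gcongr
                    · exact hHα φ
                    · exact hHβ φ
                _ = H ^ ((((g i).1 : ℕ) + (g i).2) * (q.2 : ℕ)) := by rw [← pow_add, ← pow_mul]
                _ ≤ _ := pow_le_pow_right₀ hH1 (hexp i q)
            calc _ ≤ (δ : ℝ) ^ e * (((R2 + B + S * N : ℕ) : ℝ) ^ A * H ^ e) := by gcongr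
              _ = _ := by rw [mul_pow]; ring)
        rw [hcard, nsmul_eq_mul] at h5
        exact h5)
    refine h4.trans ?_
    rw [Matrix.det_smul, map_mul, map_pow, map_pow]
    calc _ ≤ 1 * w M.det := by
          apply mul_le_mul_of_nonneg_right _ (w.nonneg _)
          exact pow_le_one₀ (by positivity) (pow_le_one₀ (w.nonneg _) (na_nat_le w hna _))
      _ = _ := one_mul _
  refine hlow.trans ?_
  -- upper bound
  set M' : Matrix (Fin A × Fin B) (Fin A × Fin B) E := Matrix.of fun i q =>
    (((g i).1 + (g i).2 * N : ℕ) : E) ^ (q.1 : ℕ) * (α ^ ((g i).1 + (g i).2 * N : ℕ)) ^ (q.2 : ℕ) with hM'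
  have hM1 : ∀ i q, w (M i q) ≤ 1 := by
    intro i q
    rw [hMe]
    simp only [map_mul, map_pow, hα1, hβ1, one_pow, mul_one]
    exact pow_le_one₀ (w.nonneg _) (na_nat_le w hna _)
  have hM'1 : ∀ i q, w (M' i q) ≤ 1 := by
    intro i q
    rw [hM', Matrix.of_apply]
    simp only [map_mul, map_pow, hα1, one_pow, mul_one]
    exact pow_le_one₀ (w.nonneg _) (na_nat_le w hna _)
  have hdiff : w (M.det - M'.det) ≤ w (α ^ N - β) := by
    apply na_det_sub w hna _ _ _ (w.nonneg _) hM1 hM'1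
    intro i q
    rw [hMe, hM', Matrix.of_apply, ← mul_sub, map_mul, map_pow]
    calc _ ≤ 1 * w ((α ^ ((g i).1 : ℕ) * β ^ ((g i).2 : ℕ)) ^ (q.2 : ℕ) - (α ^ ((g i).1 + (g i).2 * N : ℕ)) ^ (q.2 : ℕ)) := by
          apply mul_le_mul_of_nonneg_right _ (w.nonneg _)
          exact pow_le_one₀ (w.nonneg _) (na_nat_le w hna _)
      _ ≤ w (α ^ ((g i).1 : ℕ) * β ^ ((g i).2 : ℕ) - α ^ ((g i).1 + (g i).2 * N : ℕ)) := by
          rw [one_mul]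
          apply na_pow_sub w hna <;> simp [hα1, hβ1]
      _ = w (β ^ ((g i).2 : ℕ) - (α ^ N) ^ ((g i).2 : ℕ)) := by
          rw [pow_add, ← mul_sub, map_mul, map_pow, hα1, one_pow, one_mul, mul_comm _ N, pow_mul]
      _ ≤ w (β - α ^ N) := by apply na_pow_sub w hna <;> simp [hα1, hβ1]
      _ = _ := w.map_sub _ _
  have hup : w M'.det ≤ ρ ^ T := by
    have hex : ∀ q : Fin A × Fin B, ∃ f : ℕ → E, (∀ j, w (f j) ≤ ρ ^ (j - (q.1 : ℕ))) ∧ ∀ k J : ℕ, k < J →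
      (k : E) ^ (q.1 : ℕ) * (1 + (α ^ (q.2 : ℕ) - 1)) ^ k = ∑ j ∈ Finset.range J, (k.choose j : E) * f j := by
      intro q
      apply expand w hna _ ρ hρ0 hρ1
      refine le_trans ?_ hρ
      have := na_pow_sub w hna α 1 q.2 hα1.le (by simp)
      simpa using this
    choose f hf1 hf2 using hex
    apply det_upper w hna ρ hρ0 hρ1 A (R2 + B + S * N + 1) T (fun i => (g i).1 + (g i).2 * N)
      (fun i => by
        have hle : ((g i).1 + (g i).2 * N : ℕ) ≤ R2 + B + S * N :=
                Nat.add_le_add (g i).1.2.le (Nat.mul_le_mul_right _ (g i).2.2.le)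
        omega) M' f
    · intro q j
      exact (hf1 q j).trans (pow_le_pow_of_le_one hρ0 hρ1 (by have := q.1.2; omega))
    · intro i q
      rw [← hf2 q]
      · rw [hM', Matrix.of_apply, ← pow_mul, mul_comm _ (q.2 : ℕ), pow_mul]; simp
      · have hle : ((g i).1 + (g i).2 * N : ℕ) ≤ R2 + B + S * N :=
                Nat.add_le_add (g i).1.2.le (Nat.mul_le_mul_right _ (g i).2.2.le)
        omega
    · rw [hcard]; exact hT
  have : M.det = (M.det - M'.det) + M'.det := by ring
  rw [this]
  exact (hna _ _).trans (max_le_max hdiff hup)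

end Key
end S15

namespace S15

lemma exists_eighth (N : ℕ) : ∃ B : ℕ, B ^ 8 ≤ N ∧ N < (B + 1) ^ 8 := by
  induction N with
  | zero => exact ⟨0, by norm_num, by norm_num⟩
  | succ n ih =>
    obtain ⟨B, h1, h2⟩ := ih
    rcases Nat.lt_or_ge (n + 1) ((B + 1) ^ 8) with h | h
    · exact ⟨B, by omega, h⟩
    · refine ⟨B + 1, h, ?_⟩
      have : (B + 1) ^ 8 < (B + 1 + 1) ^ 8 := Nat.pow_lt_pow_left (by omega) (by norm_num)
      omega

lemma exists_kappa (lam h D : ℝ) (hlam : 0 < lam) : ∃ κ : ℕ, 1 ≤ κ ∧ D * ((4 * κ + 1) * h) + 1 ≤ lam * (κ : ℝ) ^ 2 := by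
  obtain ⟨n, hn⟩ := exists_nat_ge ((5 * |D * h| + 1) / lam)
  refine ⟨n + 1, by omega, ?_⟩
  rw [div_le_iff₀ hlam] at hn
  push_cast
  have h1 := le_abs_self (D * h)
  have h0 := abs_nonneg (D * h)
  have hn0 : (0:ℝ) ≤ n := Nat.cast_nonneg n
  have e1 : D * ((4 * ((n:ℝ) + 1) + 1) * h) ≤ (4 * ((n:ℝ) + 1) + 1) * |D * h| := by
    have : D * ((4 * ((n:ℝ) + 1) + 1) * h) = (4 * ((n:ℝ) + 1) + 1) * (D * h) := by ring
    rw [this]; gcongr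
  have e2 : (5 * |D * h| + 1) * (n + 1) ≤ lam * ((n : ℝ) + 1) ^ 2 := by
    have : (5 * |D * h| + 1) ≤ lam * ((n:ℝ) + 1) := by nlinarith
    calc _ ≤ lam * ((n:ℝ) + 1) * (n + 1) := by gcongr
      _ = _ := by ring
  nlinarith

set_option maxHeartbeats 2000000 in
lemma num_ineq (lam h ε : ℝ) (D : ℕ) (hlam : 0 < lam) (hε : 0 < ε) (κ : ℕ) (hκ1 : 1 ≤ κ)
    (hκ : (D : ℝ) * ((4 * κ + 1) * h) + 1 ≤ lam * (κ : ℝ) ^ 2) :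
    ∃ B0 : ℕ, 5 ≤ B0 ∧ 2 * κ ≤ B0 ∧ ∀ B N : ℕ, B0 ≤ B → B ^ 8 ≤ N → N < (B + 1) ^ 8 →
      ∀ Y : ℝ, Y = Real.log (4 * κ ^ 2 * B ^ 2) + (4 * κ + 1) * B ^ 2 * h
        + 4 * κ ^ 2 * B * Real.log ((4 * κ + 1) * B * (N + 1)) →
      D * Y < lam * κ ^ 2 * B ^ 2 ∧ D * ((4 * κ ^ 2 * B ^ 2) * Y) < ε * N := by
  have hlog : Tendsto (fun x : ℝ => Real.log x / x) atTop (nhds 0) :=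
    by simpa using Real.isLittleO_log_id_atTop.tendsto_div_nhds_zero
  have hlog2 : ∀ᶠ B : ℕ in atTop, Real.log ((B : ℝ) + 1) / ((B : ℝ) + 1) < 1 / (2 * (48 * (D + 1) * κ ^ 2)) := by
    have h1 : Tendsto (fun B : ℕ => (B : ℝ) + 1) atTop atTop :=
      tendsto_atTop_add_const_right _ _ tendsto_natCast_atTop_atTop
    have h2 := hlog.comp h1
    have : (0:ℝ) < 1 / (2 * (48 * (D + 1) * κ ^ 2)) := by positivity
    exact h2.eventually_lt_const this
  obtain ⟨B1, hB1⟩ := eventually_atTop.1 hlog2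
  obtain ⟨B2, hB2⟩ := exists_nat_ge (4 * κ ^ 4 * lam / ε)
  refine ⟨B1 + B2 + 5 + 4 * κ ^ 2 + 2 * κ + (4 * κ + 1), by omega, by omega, ?_⟩
  intro B N hB hN1 hN2 Y hY
  have hκR : (1:ℝ) ≤ κ := by exact_mod_cast hκ1
  have hb5 : (5:ℝ) ≤ B := by exact_mod_cast (show 5 ≤ B by omega)
  have hb6 : 4 * (κ:ℝ) ^ 2 ≤ B := by exact_mod_cast (show 4 * κ ^ 2 ≤ B by omega)
  have hb7 : 4 * (κ:ℝ) + 1 ≤ B := by exact_mod_cast (show 4 * κ + 1 ≤ B by omega)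
  have hb8 : (B2:ℝ) ≤ B := by exact_mod_cast (show B2 ≤ B by omega)
  have hN1R : (B:ℝ) ^ 8 ≤ N := by exact_mod_cast hN1
  have hN2R : (N:ℝ) + 1 ≤ ((B:ℝ) + 1) ^ 8 := by exact_mod_cast hN2
  set b : ℝ := (B : ℝ)
  set l := Real.log (b + 1) with hl
  have hl0 : 0 ≤ l := Real.log_nonneg (by linarith)
  have hlb : (48 * (D + 1) * κ ^ 2) * l < b := by
    have h1 := hB1 B (by omega)
    rw [div_lt_div_iff₀ (by positivity) (by positivity)] at h1
    have h2 : b + 1 ≤ 2 * b := by linarith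
    nlinarith
  have hlog1 : Real.log (4 * κ ^ 2 * b ^ 2) ≤ 4 * l := by
    have : 4 * (κ:ℝ) ^ 2 * b ^ 2 ≤ (b + 1) ^ 4 := by
      calc _ ≤ b * b ^ 2 := by gcongr
        _ = b ^ 3 := by ring
        _ ≤ (b + 1) ^ 3 := by gcongr; linarith
        _ ≤ (b + 1) ^ 4 := pow_le_pow_right₀ (by linarith) (by norm_num)
    calc _ ≤ Real.log ((b + 1) ^ 4) := Real.log_le_log (by positivity) this
      _ = _ := by rw [Real.log_pow, hl]; norm_num
  have hlog3 : Real.log ((4 * κ + 1) * b * (N + 1)) ≤ 10 * l := by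
    have : (4 * (κ:ℝ) + 1) * b * (N + 1) ≤ (b + 1) ^ 10 := by
      calc _ ≤ (b + 1) * (b + 1) * (b + 1) ^ 8 := by gcongr <;> linarith
        _ = _ := by ring
    calc _ ≤ Real.log ((b + 1) ^ 10) := Real.log_le_log (by positivity) this
      _ = _ := by rw [Real.log_pow, hl]; norm_num
  have hk2 : (1:ℝ) ≤ κ ^ 2 := one_le_pow₀ hκR
  have main : (D:ℝ) * Y < lam * κ ^ 2 * b ^ 2 := by
    have e1 : Y ≤ (4 * κ + 1) * b ^ 2 * h + 44 * κ ^ 2 * b * l := by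
      have : 4 * κ ^ 2 * b * Real.log ((4 * κ + 1) * b * (N + 1)) ≤ 4 * κ ^ 2 * b * (10 * l) := by gcongr
      have h4 : 4 * l ≤ 4 * (κ ^ 2 * b) * l := by
        have : 1 ≤ (κ:ℝ) ^ 2 * b := by nlinarith
        nlinarith
      rw [hY]; nlinarith
    have e2 : (D:ℝ) * Y ≤ D * ((4 * κ + 1) * b ^ 2 * h + 44 * κ ^ 2 * b * l) := by gcongr
    have e3 : D * (44 * κ ^ 2 * b * l) < b ^ 2 := by
      have : (D:ℝ) * (44 * κ ^ 2 * l) ≤ (48 * (D + 1) * κ ^ 2) * l := by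
        have : 0 ≤ (κ:ℝ) ^ 2 * l := by positivity
        have : 0 ≤ (D:ℝ) * (κ ^ 2 * l) := by positivity
        nlinarith
      have : (D:ℝ) * (44 * κ ^ 2 * l) < b := by linarith
      nlinarith
    have e4 : (D * ((4 * κ + 1) * h) + 1) * b ^ 2 ≤ lam * κ ^ 2 * b ^ 2 := by gcongr
    nlinarith
  refine ⟨main, ?_⟩
  have : (D:ℝ) * ((4 * κ ^ 2 * b ^ 2) * Y) < (4 * κ ^ 2 * b ^ 2) * (lam * κ ^ 2 * b ^ 2) := by
    calc _ = (4 * κ ^ 2 * b ^ 2) * (D * Y) := by ring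
      _ < _ := by gcongr
  refine this.trans_le ?_
  have e5 : 4 * κ ^ 4 * lam ≤ ε * b := by
    rw [div_le_iff₀ hε] at hB2
    refine hB2.trans ?_
    rw [mul_comm]
    exact mul_le_mul_of_nonneg_left hb8 hε.le
  calc _ = (4 * κ ^ 4 * lam) * b ^ 4 := by ring
    _ ≤ (ε * b) * b ^ 4 := by gcongr
    _ = ε * b ^ 5 := by ring
    _ ≤ ε * b ^ 8 := by gcongr <;> [linarith; norm_num]
    _ ≤ _ := by gcongr

section
variable {E : Type*} [Field E] [NumberField E] (w : AbsoluteValue E ℝ)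

lemma exists_den (x : E) : ∃ δ : ℕ, 0 < δ ∧ IsIntegral ℤ ((δ : E) * x) := by
  obtain ⟨y, hy, h⟩ := ((IsFractionRing.isAlgebraic_iff ℤ ℚ E).2 (Algebra.IsAlgebraic.isAlgebraic (R := ℚ) x)).exists_integral_multiple
  refine ⟨y.natAbs, Int.natAbs_pos.2 hy, ?_⟩
  rw [zsmul_eq_mul] at h
  rcases Int.natAbs_eq y with h' | h'
  · rw [h'] at h; simpa using h
  · rw [h'] at h
    have := h.neg
    simpa using this

lemma exists_house (x : E) : ∃ H : ℝ, 1 ≤ H ∧ ∀ φ : E →+* ℂ, ‖φ x‖ ≤ H := by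
  refine ⟨1 + ∑ φ : E →+* ℂ, ‖φ x‖, ?_, ?_⟩
  · have : 0 ≤ ∑ φ : E →+* ℂ, ‖φ x‖ := Finset.sum_nonneg fun _ _ => norm_nonneg _
    linarith
  · intro φ
    have := Finset.single_le_sum (f := fun φ : E →+* ℂ => ‖φ x‖) (fun _ _ => norm_nonneg _) (Finset.mem_univ φ)
    linarith

set_option maxHeartbeats 2000000 in
lemma main1 (hna : IsNonarchimedean ⇑w) (p : ℕ) (hp : p.Prime) (hw : w (p : E) = 1 / p)
    (α β : E) (hα1 : w α = 1) (hβ1 : w β = 1) (hα : ∀ n : ℕ, 0 < n → α ^ n ≠ 1) (hα' : w (α - 1) < 1)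
    (ε : ℝ) (hε : 0 < ε) : ∃ N0 : ℕ, ∀ N, N0 ≤ N → Real.exp (-(ε * N)) ≤ w (α ^ N - β) := by
  obtain ⟨δ1, hδ1, hi1⟩ := exists_den α
  obtain ⟨δ2, hδ2, hi2⟩ := exists_den β
  obtain ⟨H1, hH1, hb1⟩ := exists_house α
  obtain ⟨H2, hH2, hb2⟩ := exists_house β
  have hnat : ∀ n : ℕ, IsIntegral ℤ (n : E) := fun n => by
    have := isIntegral_algebraMap (R := ℤ) (A := E) (x := (n : ℤ))
    simpa using this
  set ρ := w (α - 1) with hρ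
  have hρ0 : 0 < ρ := by
    apply w.pos
    intro h
    exact hα 1 one_pos (by rw [pow_one]; exact sub_eq_zero.1 h)
  set δ := δ1 * δ2 with hδdef
  have hδ : 0 < δ := Nat.mul_pos hδ1 hδ2
  set H := max H1 H2 with hHdef
  have hH : 1 ≤ H := hH1.trans (le_max_left _ _)
  set lam := - Real.log ρ with hlam
  have hlam0 : 0 < lam := by have := Real.log_neg hρ0 hα'; linarith
  set h := Real.log (δ * H) with hh
  set D := Module.finrank ℚ E with hD
  obtain ⟨κ, hκ1, hκ⟩ := exists_kappa lam h D hlam0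
  obtain ⟨B0, hB5, hB2, hB0⟩ := num_ineq lam h ε D hlam0 hε κ hκ1 hκ
  refine ⟨B0 ^ 8, fun N hN => ?_⟩
  obtain ⟨B, hBN, hNB⟩ := exists_eighth N
  have hBB : B0 ≤ B := by
    by_contra hlt
    push Not at hlt
    have : (B + 1) ^ 8 ≤ B0 ^ 8 := Nat.pow_le_pow_left hlt _
    omega
  obtain ⟨hY1, hY2⟩ := hB0 B N hBB hBN hNB _ rfl
  set Y := Real.log (4 * κ ^ 2 * B ^ 2) + (4 * κ + 1) * B ^ 2 * h
        + 4 * κ ^ 2 * B * Real.log ((4 * κ + 1) * B * (N + 1)) with hYdef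
  by_contra hcon
  push Not at hcon
  have hBpos : 5 ≤ B := hB5.trans hBB
  have hkey := key w hna p hp hw α β hα1 hβ1 hα ρ hρ0.le hα'.le le_rfl δ hδ
    (by rw [hδdef]; push_cast; have := (hnat δ2).mul hi1; rwa [← mul_assoc, mul_comm (δ2 : E)] at this)
    (by rw [hδdef]; push_cast; have := (hnat δ1).mul hi2; rwa [← mul_assoc] at this)
    H hH (fun φ => (hb1 φ).trans (le_max_left _ _)) (fun φ => (hb2 φ).trans (le_max_right _ _))
    (4 * κ ^ 2 * B) B (2 * κ * B) (2 * κ * B) N ((4 * κ ^ 2 * B * B) * (κ ^ 2 * B ^ 2))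
    (by
      calc 2 * κ * B ≤ B * B := Nat.mul_le_mul_right _ (hB2.trans hBB)
        _ = B ^ 2 := by ring
        _ ≤ B ^ 8 := Nat.pow_le_pow_right (by omega) (by norm_num)
        _ ≤ N := hBN)
    (by apply le_of_eq; ring)
    (by positivity)
    (by
      have h1 : 2 * (κ ^ 2 * B ^ 2) + 2 * (4 * κ ^ 2 * B) ≤ 4 * κ ^ 2 * B * B - 1 := by
        apply Nat.le_sub_of_add_le
        have hk : 1 ≤ κ ^ 2 := Nat.one_le_pow _ _ hκ1
        have : 8 * (κ ^ 2 * B) + 1 ≤ 2 * (κ ^ 2 * B * B) := by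
          have h2 : 1 ≤ κ ^ 2 * B := Nat.mul_pos hk (by omega)
          nlinarith
        nlinarith
      calc _ = (4 * κ ^ 2 * B * B) * (2 * (κ ^ 2 * B ^ 2) + 2 * (4 * κ ^ 2 * B)) := by ring
        _ ≤ _ := Nat.mul_le_mul_left _ h1)
  set L := 4 * κ ^ 2 * B * B with hL
  set X : ℝ := (L.factorial : ℝ) * ((δ * H) ^ (B * (2 * κ * B + B + 2 * κ * B)) *
    ((2 * κ * B + B + 2 * κ * B * N : ℕ) : ℝ) ^ (4 * κ ^ 2 * B)) ^ L with hX
  have hδH : 1 ≤ (δ : ℝ) * H := by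
    have : (1:ℝ) ≤ δ := by exact_mod_cast hδ
    nlinarith
  have hκR : (1:ℝ) ≤ κ := by exact_mod_cast hκ1
  have hBR : (5:ℝ) ≤ B := by exact_mod_cast hBpos
  have hQ : (0:ℝ) < ((2 * κ * B + B + 2 * κ * B * N : ℕ) : ℝ) := by
    push_cast; positivity
  have hXpos : 0 < X := by positivity
  have hLR : (L : ℝ) = 4 * κ ^ 2 * B ^ 2 := by rw [hL]; push_cast; ring
  have hLpos : 0 < (L : ℝ) := by rw [hLR]; positivity
  have hlogX : Real.log X ≤ L * Y := by
    rw [hX, Real.log_mul (by positivity) (by positivity), Real.log_pow,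
      Real.log_mul (by positivity) (by positivity), Real.log_pow, Real.log_pow]
    have f1 : Real.log (L.factorial : ℝ) ≤ L * Real.log L := by
      rw [← Real.log_pow]
      apply Real.log_le_log (by positivity)
      exact_mod_cast Nat.factorial_le_pow L
    have f2 : Real.log ((2 * κ * B + B + 2 * κ * B * N : ℕ) : ℝ) ≤ Real.log ((4 * κ + 1) * B * (N + 1)) := by
      apply Real.log_le_log hQ
      push_cast
      have : 0 ≤ (κ:ℝ) * B := by positivity
      have : 0 ≤ (κ:ℝ) * B * N := by positivity
      have : 0 ≤ (B:ℝ) * N := by positivity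
      nlinarith
    have f3 : Y = Real.log L + (4 * κ + 1) * B ^ 2 * h
        + 4 * κ ^ 2 * B * Real.log ((4 * κ + 1) * B * (N + 1)) := by rw [hLR]
    rw [f3]
    have f4 : ((4 * κ ^ 2 * B : ℕ) : ℝ) * Real.log ((2 * κ * B + B + 2 * κ * B * N : ℕ) : ℝ) ≤
       4 * κ ^ 2 * B * Real.log ((4 * κ + 1) * B * (N + 1)) := by
      push_cast at f2 ⊢
      gcongr
    have f5 : ((B * (2 * κ * B + B + 2 * κ * B) : ℕ) : ℝ) * Real.log (δ * H) = (4 * κ + 1) * B ^ 2 * h := by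
      push_cast; rw [hh]; ring
    rw [f5]
    calc _ ≤ L * Real.log L + L * ((4 * κ + 1) * B ^ 2 * h +
            4 * κ ^ 2 * B * Real.log ((4 * κ + 1) * B * (N + 1))) := by gcongr
      _ = _ := by ring
  have hlow : Real.exp (-(D * (L * Y))) ≤ 1 / X ^ D := by
    rw [Real.exp_neg, ← one_div]
    apply one_div_le_one_div_of_le (by positivity)
    rw [← Real.exp_log hXpos, ← Real.exp_nat_mul]
    apply Real.exp_le_exp.2
    gcongr
  have hup : max (w (α ^ N - β)) (ρ ^ (L * (κ ^ 2 * B ^ 2))) < Real.exp (-(D * (L * Y))) := by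
    apply max_lt
    · refine hcon.trans ?_
      apply Real.exp_lt_exp.2
      rw [hLR]; linarith
    · rw [← Real.exp_log hρ0, ← Real.exp_nat_mul]
      apply Real.exp_lt_exp.2
      push_cast
      have e1 : Real.log ρ = -lam := by rw [hlam]; ring
      rw [e1]
      have : (L:ℝ) * (D * Y) < L * (lam * κ ^ 2 * B ^ 2) := by gcongr
      nlinarith
  linarith

/-- A unit at `w` has a power congruent to one. -/
lemma exists_unit_pow (hna : IsNonarchimedean ⇑w) (p : ℕ) (hp : p.Prime) (hw : w (p : E) = 1 / p)
    (α : E) (hα1 : w α = 1) : ∃ q : ℕ, 0 < q ∧ w (α ^ q - 1) < 1 := by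
  have : Fact p.Prime := ⟨hp⟩
  obtain ⟨f0, hf0, hf0α⟩ := (IsFractionRing.isAlgebraic_iff ℤ ℚ E).2 (Algebra.IsAlgebraic.isAlgebraic (R := ℚ) α)
  set f := f0.primPart with hf
  have hfα : aeval α f = 0 := by
    rw [f0.eq_C_content_mul_primPart, map_mul, mul_eq_zero] at hf0α
    rcases hf0α with h | h
    · exfalso
      rw [aeval_C, eq_intCast] at h
      have : f0.content = 0 := by exact_mod_cast h
      exact hf0 (content_eq_zero_iff.1 this)
    · exact h
  set fb : (ZMod p)[X] := f.map (Int.castRingHom (ZMod p)) with hfb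
  have hfb0 : fb ≠ 0 := by
    intro h0
    have hdvd : (C (p : ℤ)) ∣ f := by
      rw [C_dvd_iff_dvd_coeff]
      intro i
      have := congrArg (fun g => g.coeff i) h0
      simp only [hfb, coeff_map, coeff_zero, eq_intCast] at this
      exact (ZMod.intCast_zmod_eq_zero_iff_dvd _ p).1 this
    have hprim : f.IsPrimitive := isPrimitive_primPart f0
    have hu := hprim _ hdvd
    have := Int.isUnit_iff.1 hu
    have h2 := hp.two_le
    omega
  have hfin : Finite (AdjoinRoot fb) := by
    have : Module.Finite (ZMod p) (AdjoinRoot fb) := (AdjoinRoot.powerBasis hfb0).finite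
    exact Module.finite_of_finite (ZMod p)
  obtain ⟨m, n, hmn, heq⟩ := Finite.exists_ne_map_eq_of_infinite (fun n : ℕ => (AdjoinRoot.root fb) ^ n)
  wlog hlt : m < n generalizing m n
  · exact this n m hmn.symm heq.symm (by omega)
  have hdvd : fb ∣ X ^ n - X ^ m := by
    rw [← AdjoinRoot.mk_eq_zero, map_sub, map_pow, map_pow, AdjoinRoot.mk_X, sub_eq_zero]
    exact heq.symm
  obtain ⟨gb, hgb⟩ := hdvd
  obtain ⟨g, hg⟩ := Polynomial.map_surjective (Int.castRingHom (ZMod p)) (ZMod.ringHom_surjective _) gb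
  have hdvd2 : (C (p : ℤ)) ∣ (X ^ n - X ^ m - f * g) := by
    rw [C_dvd_iff_dvd_coeff]
    intro i
    rw [← ZMod.intCast_zmod_eq_zero_iff_dvd _ p]
    have h0 : (X ^ n - X ^ m - f * g).map (Int.castRingHom (ZMod p)) = 0 := by
      simp only [Polynomial.map_sub, Polynomial.map_mul, Polynomial.map_pow, map_X, hg]
      rw [hgb]; simp [hfb]
    have := congrArg (fun g => g.coeff i) h0
    simpa only [coeff_map, coeff_zero, eq_intCast] using this
  obtain ⟨k, hk⟩ := hdvd2
  have h1 : α ^ n - α ^ m = (p : E) * aeval α k := by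
    have := congrArg (aeval α) hk
    simp only [map_sub, map_mul, map_pow, aeval_X, hfα, aeval_C] at this
    simpa using this
  have h2 : w (aeval α k) ≤ 1 := by
    rw [aeval_eq_sum_range]
    apply na_sum_le w hna _ _ _ zero_le_one
    intro i _
    rw [zsmul_eq_mul, map_mul, map_pow, hα1, one_pow, mul_one]
    exact na_int_le w hna _
  refine ⟨n - m, by omega, ?_⟩
  have h3 : α ^ n - α ^ m = α ^ m * (α ^ (n - m) - 1) := by
    rw [mul_sub, ← pow_add, mul_one]; congr 2; omega
  have h4 : w (α ^ (n - m) - 1) = w (p : E) * w (aeval α k) := by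
    rw [← map_mul, ← h1, h3, map_mul, map_pow, hα1, one_pow, one_mul]
  rw [h4, hw]
  have hp1 : (1:ℝ) < p := by exact_mod_cast hp.one_lt
  have : 1 / (p:ℝ) < 1 := by rw [div_lt_one (by linarith)]; exact hp1
  calc _ ≤ 1 / (p:ℝ) * 1 := by gcongr
    _ < 1 := by linarith

lemma main2 (hna : IsNonarchimedean ⇑w) (p : ℕ) (hp : p.Prime) (hw : w (p : E) = 1 / p)
    (α β : E) (hα1 : w α = 1) (hβ1 : w β = 1) (hα : ∀ n : ℕ, 0 < n → α ^ n ≠ 1)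
    (ε : ℝ) (hε : 0 < ε) : ∃ N0 : ℕ, ∀ N, N0 ≤ N → Real.exp (-(ε * N)) ≤ w (α ^ N - β) := by
  obtain ⟨q, hq, hq1⟩ := exists_unit_pow w hna p hp hw α hα1
  obtain ⟨N0, h⟩ := main1 w hna p hp hw (α ^ q) (β ^ q) (by simp [hα1]) (by simp [hβ1])
    (fun n hn => by rw [← pow_mul]; exact hα _ (Nat.mul_pos hq hn)) hq1 ε hε
  refine ⟨N0, fun N hN => (h N hN).trans ?_⟩
  rw [← pow_mul, mul_comm, pow_mul]
  exact na_pow_sub w hna _ _ _ (by simp [hα1]) hβ1.le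

end
end S15



namespace S15

lemma qbar_alg : Algebra.IsAlgebraic ℚ Qbar := by
  have h := AlgebraicClosure.isAlgebraic ℚ
  have e : (DivisionRing.toRatAlgebra : Algebra ℚ Qbar) = AlgebraicClosure.instAlgebra ℚ :=
    Subsingleton.elim _ _
  rw [e]
  exact h

lemma qbar_int (x : Qbar) : IsIntegral ℚ x :=
  (qbar_alg.isAlgebraic x).isIntegral

lemma qbar_intK (K : IntermediateField ℚ Qbar) (x : Qbar) : IsIntegral ↥K x :=
  (qbar_int x).tower_top

lemma main3 (W : AbsoluteValue Qbar ℝ) (hna : IsNonarchimedean ⇑W) (p : ℕ) (hp : p.Prime)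
    (hw : W (p : Qbar) = 1 / p)
    (α β : Qbar) (hα1 : W α = 1) (hβ1 : W β = 1) (hα : ∀ n : ℕ, 0 < n → α ^ n ≠ 1)
    (ε : ℝ) (hε : 0 < ε) : ∃ N0 : ℕ, ∀ N, N0 ≤ N → Real.exp (-(ε * N)) ≤ W (α ^ N - β) := by
  let E : IntermediateField ℚ Qbar := IntermediateField.adjoin ℚ {α, β}
  have hfd : FiniteDimensional ℚ E := IntermediateField.finiteDimensional_adjoin
    (fun x _ => qbar_int x)
  have : NumberField E := ⟨⟩
  have hαE : α ∈ E := IntermediateField.subset_adjoin _ _ (by simp)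
  have hβE : β ∈ E := IntermediateField.subset_adjoin _ _ (by simp)
  let w' : AbsoluteValue E ℝ := W.comp (f := algebraMap E Qbar) (algebraMap E Qbar).injective
  have hw' : ∀ x : E, w' x = W (x : Qbar) := fun x => rfl
  obtain ⟨N0, h⟩ := main2 w' (fun x y => by simpa [hw'] using hna x y) p hp
    (by rw [hw', ← hw]; simp) ⟨α, hαE⟩ ⟨β, hβE⟩ hα1 hβ1
    (fun n hn h => hα n hn (by simpa using congrArg (algebraMap E Qbar) h)) ε hε
  exact ⟨N0, fun N hN => by simpa [hw'] using h N hN⟩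

lemma prod_lower (W : AbsoluteValue Qbar ℝ) (hna : IsNonarchimedean ⇑W) (α b : Qbar) (hα : W α ≤ 1)
    (hb : W b = 1) (N : ℕ) (hN : 0 < N) (s : Finset Qbar) (hs : ∀ z ∈ s, z ^ N = b) :
    W (α ^ N - b) ≤ ∏ z ∈ s, W (z - α) := by
  classical
  have hroot : ∀ z : Qbar, z ^ N = b → W z ≤ 1 := by
    intro z hz
    have : W z ^ N = 1 := by rw [← map_pow, hz, hb]
    exact ((pow_eq_one_iff_of_nonneg (W.nonneg _) hN.ne').1 this).le
  have hmon : (X ^ N - C b : Qbar[X]).Monic := monic_X_pow_sub_C b hN.ne'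
  have hmem : ∀ z, z ∈ (X ^ N - C b : Qbar[X]).roots ↔ z ^ N = b := by
    intro z
    rw [mem_roots hmon.ne_zero]; simp [sub_eq_zero]
  have hle : s.val ≤ (X ^ N - C b : Qbar[X]).roots := by
    rw [Finset.val_le_iff_val_subset]
    intro z hz
    exact (hmem z).2 (hs z hz)
  obtain ⟨t, ht⟩ := Multiset.le_iff_exists_add.1 hle
  have hspl := (IsAlgClosed.splits (X ^ N - C b : Qbar[X])).eq_prod_roots_of_monic hmon
  have hev : α ^ N - b = (((X ^ N - C b : Qbar[X]).roots).map (fun z => α - z)).prod := by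
    have := congrArg (eval α) hspl
    rw [eval_multiset_prod, Multiset.map_map] at this
    simpa using this
  rw [hev, ht, Multiset.map_add, Multiset.prod_add, map_mul]
  have h1 : W ((t.map (fun z => α - z)).prod) ≤ 1 := by
    have ht' : ∀ z ∈ t, W (α - z) ≤ 1 := by
      intro z hz
      have : z ∈ (X ^ N - C b : Qbar[X]).roots := by rw [ht]; exact Multiset.mem_add.2 (Or.inr hz)
      exact (na_sub_le W hna _ _).trans (max_le hα (hroot z ((hmem z).1 this)))
    clear ht
    induction t using Multiset.induction_on with
    | empty => simp
    | cons a t ih =>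
      rw [Multiset.map_cons, Multiset.prod_cons, map_mul]
      exact mul_le_one₀ (ht' a (by simp)) (W.nonneg _) (ih fun z hz => ht' z (by simp [hz]))
  have h2 : W ((s.val.map (fun z => α - z)).prod) = ∏ z ∈ s, W (z - α) := by
    change W (∏ z ∈ s, (α - z)) = _
    rw [map_prod]
    exact Finset.prod_congr rfl fun z _ => W.map_sub _ _
  rw [h2]
  calc _ ≤ (∏ z ∈ s, W (z - α)) * 1 :=
        mul_le_mul_of_nonneg_left h1 (Finset.prod_nonneg fun _ _ => W.nonneg _)
    _ = _ := mul_one _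

lemma log_lower (W : AbsoluteValue Qbar ℝ) (hna : IsNonarchimedean ⇑W) (α b : Qbar) (hα : W α ≤ 1)
    (hb : W b = 1) (N : ℕ) (hN : 0 < N) (s : Finset Qbar) (hs : ∀ z ∈ s, z ^ N = b) (c : ℝ)
    (hc : Real.exp c ≤ W (α ^ N - b)) :
    c ≤ ∑ z ∈ s, Real.log (W (z - α)) := by
  have h := hc.trans (prod_lower W hna α b hα hb N hN s hs)
  have hpos : 0 < ∏ z ∈ s, W (z - α) := (Real.exp_pos c).trans_le h
  have hne : ∀ z ∈ s, W (z - α) ≠ 0 := fun z hz h0 => by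
    rw [Finset.prod_eq_zero hz h0] at hpos
    exact lt_irrefl _ hpos
  rw [← Real.log_prod hne, Real.le_log_iff_exp_le hpos]
  exact h

lemma pow_inj_of {F : Type*} [Field F] (α : F) (hα0 : α ≠ 0) (hα : ∀ n : ℕ, 0 < n → α ^ n ≠ 1) :
    ∀ i k : ℕ, α ^ i = α ^ k → i = k := by
  have key : ∀ i k : ℕ, i < k → α ^ i ≠ α ^ k := by
    intro i k hik h
    apply hα (k - i) (by omega)
    have : α ^ k = α ^ i * α ^ (k - i) := by rw [← pow_add]; congr 1; omega
    rw [this] at h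
    exact (mul_left_cancel₀ (pow_ne_zero i hα0) (by rw [mul_one]; exact h)).symm
  intro i k h
  rcases lt_trichotomy i k with h' | h' | h'
  · exact (key _ _ h' h).elim
  · exact h'
  · exact (key _ _ h' h.symm).elim

lemma deg_lower (K : IntermediateField ℚ Qbar) [NumberField ↥K] (β : ↥K) (hβ0 : β ≠ 0)
    (hβ : ∀ n : ℕ, 0 < n → β ^ n ≠ 1) :
    ∃ c : ℝ, 0 < c ∧ ∀ (γ : Qbar) (N : ℕ), 0 < N → γ ^ N = algebraMap ↥K Qbar β →
      c * N ≤ (minpoly ↥K γ).natDegree := by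
  obtain ⟨δ, hδ, hδi⟩ := exists_den β
  obtain ⟨H, hH1, hH⟩ := exists_house β
  have hfin := NumberField.Embeddings.finite_of_norm_le ↥K ℂ (δ * H)
  set F := {x : ↥K | IsIntegral ℤ x ∧ ∀ φ : ↥K →+* ℂ, ‖φ x‖ ≤ δ * H} with hF
  have hδ0 : (δ : ↥K) ≠ 0 := by exact_mod_cast hδ.ne'
  have hex : ∀ κ : ↥K, ∃ c : ℝ, 0 < c ∧ ∀ N e : ℕ, 0 < N → 0 < e → (κ / δ) ^ N = β ^ e → c * N ≤ e := by
    intro κ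
    by_cases h : ∃ N e : ℕ, 0 < N ∧ 0 < e ∧ (κ / δ) ^ N = β ^ e
    · obtain ⟨N1, e1, hN1, he1, h1⟩ := h
      refine ⟨e1 / N1, by positivity, ?_⟩
      intro N e hN he h2
      have h3 : β ^ (e * N1) = β ^ (e1 * N) := by
        rw [pow_mul, ← h2, pow_mul, ← h1, ← pow_mul, ← pow_mul, mul_comm]
      have h4 := pow_inj_of β hβ0 hβ _ _ h3
      have h5 : (e : ℝ) * N1 = e1 * N := by exact_mod_cast h4
      have : (0:ℝ) < N1 := by exact_mod_cast hN1
      rw [div_mul_eq_mul_div, div_le_iff₀ this, h5]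
    · push Not at h
      exact ⟨1, one_pos, fun N e hN he h2 => (h N e hN he h2).elim⟩
  choose c hc0 hc using hex
  have hmin : ∃ c0 : ℝ, 0 < c0 ∧ c0 ≤ 1 ∧ ∀ κ ∈ F, c0 ≤ c κ := by
    rcases F.eq_empty_or_nonempty with h | h
    · exact ⟨1, one_pos, le_rfl, by rw [h]; simp⟩
    · obtain ⟨κ, hκ, hm⟩ := Set.exists_min_image F c hfin h
      exact ⟨min 1 (c κ), lt_min one_pos (hc0 κ), min_le_left _ _, fun κ' h' => (min_le_right _ _).trans (hm κ' h')⟩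
  obtain ⟨c0, hc00, hc01, hc0F⟩ := hmin
  refine ⟨c0, hc00, fun γ N hN hγ => ?_⟩
  have hint : IsIntegral ↥K γ := qbar_intK K γ
  set e := (minpoly ↥K γ).natDegree with he
  have he0 : 0 < e := minpoly.natDegree_pos hint
  rcases le_or_gt N e with hle | hlt
  · have : (N : ℝ) ≤ e := by exact_mod_cast hle
    nlinarith [Nat.cast_nonneg (α := ℝ) N]
  let L := IntermediateField.adjoin ↥K {γ}
  let g : L := IntermediateField.AdjoinSimple.gen ↥K γ
  have hg : g ^ N = algebraMap ↥K L β := by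
    apply (algebraMap L Qbar).injective
    rw [map_pow, IntermediateField.AdjoinSimple.algebraMap_gen, hγ]
    rfl
  set κ : ↥K := Algebra.norm ↥K g with hκ
  have hκN : κ ^ N = β ^ e := by
    rw [hκ, ← map_pow, hg, Algebra.norm_algebraMap, IntermediateField.adjoin.finrank hint]
  have hmem : (δ : ↥K) * κ ∈ F := by
    constructor
    · apply IsIntegral.of_pow hN
      have : ((δ : ↥K) * κ) ^ N = (δ : ↥K) ^ (N - e) * ((δ : ↥K) * β) ^ e := by
        rw [mul_pow, hκN, mul_pow, ← mul_assoc, ← pow_add, Nat.sub_add_cancel hlt.le]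
      rw [this]
      have hnat : IsIntegral ℤ (δ : ↥K) := by
        have := isIntegral_algebraMap (R := ℤ) (A := ↥K) (x := (δ : ℤ))
        simpa using this
      exact (hnat.pow _).mul (hδi.pow _)
    · intro φ
      rw [map_mul, norm_mul, map_natCast, Complex.norm_natCast]
      gcongr
      have h1 : ‖φ κ‖ ^ N ≤ H ^ N := by
        rw [← norm_pow, ← map_pow, hκN, map_pow, norm_pow]
        calc _ ≤ H ^ e := by gcongr; exact hH φ
          _ ≤ _ := pow_le_pow_right₀ hH1 hlt.le
      exact (pow_le_pow_iff_left₀ (norm_nonneg _) (by linarith) hN.ne').1 h1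
  have := hc _ N e hN he0 (by rw [mul_div_cancel_left₀ _ hδ0]; exact hκN)
  have h2 := hc0F _ hmem
  calc _ ≤ c (δ * κ) * N := by gcongr
    _ ≤ _ := this

lemma deg_tower (K : IntermediateField ℚ Qbar) [NumberField ↥K] (γ : Qbar) :
    (minpoly ℚ γ).natDegree ≤ Module.finrank ℚ ↥K * (minpoly ↥K γ).natDegree := by
  have hint : IsIntegral ↥K γ := qbar_intK K γ
  let L := IntermediateField.adjoin ↥K {γ}
  let g : L := IntermediateField.AdjoinSimple.gen ↥K γ
  have : FiniteDimensional ↥K L := IntermediateField.adjoin.finiteDimensional hint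
  have : Module.Free ↥K L := Module.Free.of_divisionRing ↥K L
  have : FiniteDimensional ℚ L := FiniteDimensional.trans ℚ ↥K L
  rw [← IntermediateField.adjoin.finrank hint, Module.finrank_mul_finrank ℚ ↥K L]
  have h1 : minpoly ℚ γ = minpoly ℚ g := by
    have := minpoly.algebraMap_eq (A := ℚ) (B := L) (B' := Qbar) (algebraMap L Qbar).injective g
    rw [← this]; rfl
  rw [h1]
  exact minpoly.natDegree_le g

lemma deg_torsion (K : IntermediateField ℚ Qbar) [NumberField ↥K] (Q : ℕ) (hQ : 0 < Q) :
    ∃ c : ℝ, 0 < c ∧ ∀ (γ : Qbar) (k : ℕ), γ ^ (Q ^ k) = 1 → 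
      c * orderOf γ ≤ (minpoly ↥K γ).natDegree := by
  set D := Module.finrank ℚ ↥K with hD
  have hD0 : (0:ℝ) < D := by exact_mod_cast Module.finrank_pos
  have hfac : ∀ q ∈ Q.primeFactors, 0 < 1 - (q : ℝ)⁻¹ ∧ 1 - (q : ℝ)⁻¹ ≤ 1 := by
    intro q hq
    have : (1:ℝ) < q := by exact_mod_cast (Nat.prime_of_mem_primeFactors hq).one_lt
    have h2 : (q:ℝ)⁻¹ < 1 := inv_lt_one_of_one_lt₀ this
    have h3 : 0 < (q:ℝ)⁻¹ := by positivity
    constructor <;> linarith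
  set c := ∏ q ∈ Q.primeFactors, (1 - (q : ℝ)⁻¹) with hc
  have hc0 : 0 < c := Finset.prod_pos fun q hq => (hfac q hq).1
  refine ⟨c / D, by positivity, ?_⟩
  intro γ k hγ
  set M := orderOf γ with hM
  have hQk : 0 < Q ^ k := by positivity
  have hMpos : 0 < M := orderOf_pos_iff.2 (isOfFinOrder_iff_pow_eq_one.2 ⟨_, hQk, hγ⟩)
  have hdvd : M ∣ Q ^ k := orderOf_dvd_of_pow_eq_one hγ
  have hsub : M.primeFactors ⊆ Q.primeFactors := by
    intro q hq
    have hqp := Nat.prime_of_mem_primeFactors hq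
    exact Nat.mem_primeFactors.2 ⟨hqp, hqp.dvd_of_dvd_pow ((Nat.dvd_of_mem_primeFactors hq).trans hdvd), hQ.ne'⟩
  have hphi : (M : ℝ) * c ≤ M.totient := by
    have h1 := Nat.totient_eq_mul_prod_factors M
    have h2 : (M.totient : ℝ) = M * ∏ q ∈ M.primeFactors, (1 - (q : ℝ)⁻¹) := by
      have h2 := congrArg (Rat.cast : ℚ → ℝ) h1
      push_cast at h2
      exact h2
    rw [h2]
    gcongr
    rw [hc, ← Finset.prod_sdiff hsub]
    have h3 : ∏ q ∈ Q.primeFactors \ M.primeFactors, (1 - (q : ℝ)⁻¹) ≤ 1 :=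
      Finset.prod_le_one (fun q hq => (hfac q (Finset.mem_sdiff.1 hq).1).1.le) (fun q hq => (hfac q (Finset.mem_sdiff.1 hq).1).2)
    have h4 : 0 ≤ ∏ q ∈ M.primeFactors, (1 - (q : ℝ)⁻¹) :=
      Finset.prod_nonneg fun q hq => (hfac q (hsub hq)).1.le
    calc _ ≤ 1 * ∏ q ∈ M.primeFactors, (1 - (q : ℝ)⁻¹) := mul_le_mul_of_nonneg_right h3 h4
      _ = _ := one_mul _
  have hmin : (minpoly ℚ γ).natDegree = M.totient := by
    have hprim : IsPrimitiveRoot γ M := IsPrimitiveRoot.orderOf γ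
    rw [← cyclotomic_eq_minpoly_rat hprim hMpos, natDegree_cyclotomic]
  have ht := deg_tower K γ
  rw [hmin] at ht
  have ht' : (M.totient : ℝ) ≤ D * (minpoly ↥K γ).natDegree := by exact_mod_cast ht
  rw [div_mul_eq_mul_div, div_le_iff₀ hD0]
  nlinarith

end S15


namespace S15

lemma roots_pow (K : IntermediateField ℚ Qbar) (γ : Qbar) (N : ℕ) (b : ↥K)
    (h : γ ^ N = algebraMap ↥K Qbar b) :
    ∀ z ∈ ((minpoly ↥K γ).rootSet Qbar).toFinset, z ^ N = algebraMap ↥K Qbar b := by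
  intro z hz
  rw [Set.mem_toFinset, mem_rootSet] at hz
  have hd : minpoly ↥K γ ∣ X ^ N - C b := minpoly.dvd _ _ (by simp [h])
  obtain ⟨q, hq⟩ := hd
  have h1 : aeval z (X ^ N - C b : (↥K)[X]) = 0 := by rw [hq, map_mul, hz.2, zero_mul]
  simpa [sub_eq_zero] using h1

lemma roots_card (K : IntermediateField ℚ Qbar) (γ : Qbar) :
    ((minpoly ↥K γ).rootSet Qbar).toFinset.card = (minpoly ↥K γ).natDegree := by
  rw [Set.toFinset_card]
  exact card_rootSet_eq_natDegree (minpoly.irreducible (qbar_intK K γ)).separable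
    (IsAlgClosed.splits _)

lemma ev_big (γ : ℕ → Qbar) (hγ : Function.Injective γ) (b : Qbar) (M : ℕ) :
    ∀ᶠ m in atTop, ∀ k, 0 < k → γ m ^ k = b → M ≤ k := by
  classical
  have hfin : (⋃ k ∈ Finset.Ico 1 M, ((nthRoots k b).toFinset : Set Qbar)).Finite :=
    Set.Finite.biUnion (Finset.finite_toSet _) fun k _ => Finset.finite_toSet _
  have h1 := hγ.tendsto_cofinite.eventually hfin.eventually_cofinite_notMem
  rw [Nat.cofinite_eq_atTop] at h1
  filter_upwards [h1] with m hm k hk hkb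
  by_contra hlt
  apply hm
  simp only [Set.mem_iUnion]
  refine ⟨k, by simp; omega, ?_⟩
  simp [mem_nthRoots hk, hkb]

lemma tors_lower (W : AbsoluteValue Qbar ℝ) (α b : Qbar) (t : ℕ) (ht : 0 < t) (hαt : α ^ t = 1) :
    ∃ c : ℝ, ∀ N : ℕ, α ^ N ≠ b → Real.exp c ≤ W (α ^ N - b) := by
  obtain ⟨r, hr, hm⟩ := Finset.exists_min_image (Finset.range t)
    (fun r => Real.log (W (α ^ r - b))) ⟨0, by simpa using ht⟩
  refine ⟨Real.log (W (α ^ r - b)), fun N hN => ?_⟩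
  have hpos : 0 < W (α ^ N - b) := W.pos (sub_ne_zero.2 hN)
  rw [← Real.le_log_iff_exp_le hpos, pow_eq_pow_mod N hαt]
  exact hm _ (by simpa using Nat.mod_lt _ ht)

lemma ev_lin (f : ℕ → ℕ) (hf : ∀ M, ∀ᶠ m in atTop, M ≤ f m) (η c : ℝ) (hη : 0 < η) :
    ∀ᶠ m in atTop, -(η * f m) ≤ c := by
  filter_upwards [hf (Nat.ceil (-c / η))] with m hm
  have : -c / η ≤ f m := (Nat.le_ceil _).trans (by exact_mod_cast hm)
  rw [div_le_iff₀ hη] at this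
  linarith

lemma hard (W : AbsoluteValue Qbar ℝ) (hna : IsNonarchimedean ⇑W) (p : ℕ) (hp : p.Prime)
    (hw : W (p : Qbar) = 1 / p) (K : IntermediateField ℚ Qbar) [NumberField ↥K]
    (d : ℕ) (hd : 2 ≤ d) (β : ↥K) (hβ : β ≠ 0)
    (α : Qbar) (hα : ∀ n : ℕ, α ^ d ^ n ≠ algebraMap ↥K Qbar β)
    (γ : ℕ → Qbar) (hγinj : Function.Injective γ) (n : ℕ → ℕ)
    (hγ : ∀ m : ℕ, (γ m) ^ d ^ (n m) = algebraMap ↥K Qbar β)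
    (hα1 : W α = 1) (hβ1 : W (algebraMap ↥K Qbar β) = 1) (η : ℝ) (hη : 0 < η) :
    ∀ᶠ m in atTop, -(η * (minpoly ↥K (γ m)).natDegree) ≤
      ∑ z ∈ ((minpoly ↥K (γ m)).rootSet Qbar).toFinset, Real.log (W (z - α)) := by
  have hd0 : ∀ k, 0 < d ^ k := fun k => by positivity
  have hNbig : ∀ M, ∀ᶠ m in atTop, M ≤ d ^ n m := by
    intro M
    filter_upwards [ev_big γ hγinj (algebraMap ↥K Qbar β) M] with m hm
    exact hm _ (hd0 _) (hγ m)
  by_cases hβt : ∀ k : ℕ, 0 < k → β ^ k ≠ 1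
  · obtain ⟨c, hc0, hc⟩ := deg_lower K β hβ hβt
    by_cases hαt : ∀ k : ℕ, 0 < k → α ^ k ≠ 1
    · obtain ⟨N0, hN0⟩ := main3 W hna p hp hw α (algebraMap ↥K Qbar β) hα1 hβ1 hαt (η * c) (by positivity)
      filter_upwards [hNbig N0] with m hm
      refine le_trans ?_ (log_lower W hna α _ hα1.le hβ1 (d ^ n m) (hd0 _) _
        (roots_pow K (γ m) _ β (hγ m)) _ (hN0 _ hm))
      have := hc (γ m) _ (hd0 _) (hγ m)
      nlinarith
    · push Not at hαt
      obtain ⟨t, ht, hαt⟩ := hαt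
      obtain ⟨c', hc'⟩ := tors_lower W α (algebraMap ↥K Qbar β) t ht hαt
      filter_upwards [ev_lin _ hNbig (η * c) c' (by positivity)] with m hm
      refine le_trans ?_ (log_lower W hna α _ hα1.le hβ1 (d ^ n m) (hd0 _) _
        (roots_pow K (γ m) _ β (hγ m)) _ (hc' _ (hα _)))
      have := hc (γ m) _ (hd0 _) (hγ m)
      nlinarith
  · push Not at hβt
    obtain ⟨t, ht, hβt⟩ := hβt
    obtain ⟨c, hc0, hc⟩ := deg_torsion K (d * t) (by positivity)
    have hpow : ∀ m, γ m ^ (d ^ n m * t) = 1 := fun m => by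
      rw [pow_mul, hγ, ← map_pow, hβt, map_one]
    have hdeg : ∀ m, c * orderOf (γ m) ≤ (minpoly ↥K (γ m)).natDegree := by
      intro m
      apply hc (γ m) (n m + 1)
      have : (d * t) ^ (n m + 1) = (d ^ n m * t) * (d * t ^ n m) := by ring
      rw [this, pow_mul, hpow, one_pow]
    have hMpos : ∀ m, 0 < orderOf (γ m) := fun m =>
      orderOf_pos_iff.2 (isOfFinOrder_iff_pow_eq_one.2 ⟨_, by have := hd0 (n m); positivity, hpow m⟩)
    have hMbig : ∀ M, ∀ᶠ m in atTop, M ≤ orderOf (γ m) := by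
      intro M
      filter_upwards [ev_big γ hγinj 1 M] with m hm
      exact hm _ (hMpos m) (pow_orderOf_eq_one _)
    by_cases hαt : ∀ k : ℕ, 0 < k → α ^ k ≠ 1
    · obtain ⟨N0, hN0⟩ := main3 W hna p hp hw α 1 hα1 (map_one W) hαt (η * c) (by positivity)
      filter_upwards [hMbig N0] with m hm
      refine le_trans ?_ (log_lower W hna α 1 hα1.le (map_one W) (orderOf (γ m)) (hMpos m) _
        (fun z hz => by
          have := roots_pow K (γ m) (orderOf (γ m)) 1 (by rw [pow_orderOf_eq_one, map_one]) z hz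
          rwa [map_one] at this) _ (hN0 _ hm))
      have := hdeg m
      nlinarith
    · push Not at hαt
      obtain ⟨t', ht', hαt⟩ := hαt
      obtain ⟨c', hc'⟩ := tors_lower W α (algebraMap ↥K Qbar β) t' ht' hαt
      filter_upwards [ev_lin _ hMbig (η * c) c' (by positivity)] with m hm
      refine le_trans ?_ (log_lower W hna α _ hα1.le hβ1 (d ^ n m) (hd0 _) _
        (roots_pow K (γ m) _ β (hγ m)) _ (hc' _ (hα _)))
      have := hdeg m
      nlinarith

lemma na_eq_max (W : AbsoluteValue Qbar ℝ) (hna : IsNonarchimedean ⇑W) (x y : Qbar)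
    (h : W x ≠ W y) : W (x - y) = max (W x) (W y) := by
  have hn : W (-y) = W y := W.map_neg y
  have key : ∀ a b : Qbar, W a < W b → W (a + b) = W b := by
    intro a b hab
    apply le_antisymm ((hna a b).trans (max_le hab.le le_rfl))
    by_contra hlt
    push Not at hlt
    have h1 := na_sub_le W hna (a + b) a
    rw [add_sub_cancel_left] at h1
    exact absurd h1 (not_le.2 (max_lt hlt hab))
  rcases lt_or_gt_of_ne h with h | h
  · rw [sub_eq_add_neg, key _ _ (by rwa [hn]), hn, max_eq_right h.le]
  · rw [sub_eq_add_neg, add_comm, key _ _ (by rwa [hn]), max_eq_left h.le]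

lemma final (W : AbsoluteValue Qbar ℝ) (hna : IsNonarchimedean ⇑W) (p : ℕ) (hp : p.Prime)
    (hw : W (p : Qbar) = 1 / p) (K : IntermediateField ℚ Qbar) [NumberField ↥K]
    (d : ℕ) (hd : 2 ≤ d) (β : ↥K) (hβ : β ≠ 0)
    (α : Qbar) (hα : ∀ n : ℕ, α ^ d ^ n ≠ algebraMap ↥K Qbar β)
    (γ : ℕ → Qbar) (hγinj : Function.Injective γ)
    (hγ : ∀ m : ℕ, ∃ n : ℕ, (γ m) ^ d ^ n = algebraMap ↥K Qbar β) :
    Tendsto (fun m : ℕ => ((minpoly ↥K (γ m)).natDegree : ℝ)⁻¹ *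
        ∑ z ∈ ((minpoly ↥K (γ m)).rootSet Qbar).toFinset, Real.log (W (z - α)))
      atTop (nhds (Real.log (max 1 (W α)))) := by
  choose n hn using hγ
  have hd0 : ∀ k, 0 < d ^ k := fun k => by positivity
  have he0 : ∀ m, (0:ℝ) < (minpoly ↥K (γ m)).natDegree := fun m => by
    exact_mod_cast minpoly.natDegree_pos (qbar_intK K (γ m))
  set b := algebraMap ↥K Qbar β with hb
  have hb0 : 0 < W b := W.pos (by rw [hb]; simpa using hβ)
  by_cases hcase : W α = 1 ∧ W b = 1
  · obtain ⟨hα1, hb1⟩ := hcase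
    rw [hα1, max_self, Real.log_one, Metric.tendsto_nhds]
    intro ε hε
    filter_upwards [hard W hna p hp hw K d hd β hβ α hα γ hγinj n hn hα1 hb1 (ε / 2) (by positivity)] with m hm
    have hle : ∑ z ∈ ((minpoly ↥K (γ m)).rootSet Qbar).toFinset, Real.log (W (z - α)) ≤ 0 := by
      apply Finset.sum_nonpos
      intro z hz
      have hzN := roots_pow K (γ m) _ β (hn m) z hz
      have hz1 : W z = 1 := by
        have : W z ^ (d ^ n m) = 1 := by rw [← map_pow, hzN, hb1]
        exact (pow_eq_one_iff_of_nonneg (W.nonneg _) (hd0 _).ne').1 this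
      apply Real.log_nonpos (W.nonneg _)
      have := na_sub_le W hna z α
      rwa [hz1, hα1, max_self] at this
    rw [Real.dist_eq, sub_zero, abs_mul, abs_of_pos (inv_pos.2 (he0 m)), abs_of_nonpos hle,
      inv_mul_lt_iff₀ (he0 m)]
    have := he0 m
    nlinarith
  · have hNinf : Tendsto (fun m => ((d ^ n m : ℕ) : ℝ)) atTop atTop := by
      apply tendsto_natCast_atTop_atTop.comp
      rw [tendsto_atTop]
      intro M
      filter_upwards [ev_big γ hγinj b M] with m hm
      exact hm _ (hd0 _) (hn m)
    set r : ℕ → ℝ := fun m => Real.exp (Real.log (W b) / ((d ^ n m : ℕ) : ℝ)) with hr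
    have hrlim : Tendsto r atTop (nhds 1) := by
      have := (Real.continuous_exp.tendsto 0).comp (hNinf.const_div_atTop (Real.log (W b)))
      rwa [Real.exp_zero] at this
    have hrne : ∀ᶠ m in atTop, r m ≠ W α := by
      by_cases h1 : W α = 1
      · refine Eventually.of_forall fun m h => hcase ⟨h1, ?_⟩
        rw [h1, hr] at h
        have h2 := (Real.exp_eq_one_iff _).1 h
        have h3 : ((d ^ n m : ℕ) : ℝ) ≠ 0 := by exact_mod_cast (hd0 _).ne'
        have h4 : Real.log (W b) = 0 := by
          rcases div_eq_zero_iff.1 h2 with h | h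
          · exact h
          · exact absurd h h3
        exact Real.eq_one_of_pos_of_log_eq_zero hb0 h4
      · exact hrlim.eventually_ne (Ne.symm h1)
    have hlim : Tendsto (fun m => Real.log (max (r m) (W α))) atTop (nhds (Real.log (max 1 (W α)))) := by
      apply Tendsto.log
      · exact hrlim.max tendsto_const_nhds
      · have : (0:ℝ) < max 1 (W α) := lt_max_of_lt_left one_pos
        exact this.ne'
    apply hlim.congr'
    filter_upwards [hrne] with m hm
    have hterm : ∀ z ∈ ((minpoly ↥K (γ m)).rootSet Qbar).toFinset,
        Real.log (W (z - α)) = Real.log (max (r m) (W α)) := by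
      intro z hz
      have hzN := roots_pow K (γ m) _ β (hn m) z hz
      have hz1 : W z = r m := by
        have h1 : W z ^ (d ^ n m) = r m ^ (d ^ n m) := by
          rw [← map_pow, hzN, hr, ← Real.exp_nat_mul, mul_div_cancel₀, Real.exp_log hb0]
          exact_mod_cast (hd0 _).ne'
        exact (pow_left_inj₀ (W.nonneg _) (Real.exp_pos _).le (hd0 _).ne').1 h1
      rw [na_eq_max W hna z α (by rwa [hz1]), hz1]
    rw [Finset.sum_congr rfl hterm, Finset.sum_const, roots_card, nsmul_eq_mul,
      inv_mul_cancel_left₀ (he0 m).ne']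

end S15

theorem stmt_15 (p : ℕ) (hp : p.Prime)
    (K : IntermediateField ℚ Qbar) [NumberField ↥K]
    (Ω : Type) [Field Ω] [IsAlgClosed Ω]
    (w : AbsoluteValue Ω ℝ) (hna : IsNonarchimedean ⇑w) (hw : w (p : Ω) = 1 / p)
    (j : Qbar →+* Ω)
    (d : ℕ) (hd : 2 ≤ d)
    (β : ↥K) (hβ : β ≠ 0)
    (α : Qbar) (hα : ∀ n : ℕ, α ^ d ^ n ≠ algebraMap ↥K Qbar β)
    (γ : ℕ → Qbar) (hγinj : Function.Injective γ)
    (hγ : ∀ m : ℕ, ∃ n : ℕ, (γ m) ^ d ^ n = algebraMap ↥K Qbar β) :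
    Tendsto
      (fun m : ℕ =>
        (((minpoly ↥K (γ m)).natDegree * Module.finrank ℚ ↥K : ℕ) : ℝ)⁻¹ *
          ∑ z ∈ ((minpoly ↥K (γ m)).rootSet Qbar).toFinset,
            Real.log (w (j z - j α)))
      atTop
      (nhds ((Module.finrank ℚ ↥K : ℝ)⁻¹ * Real.log (max 1 (w (j α))))) := by
  let W : AbsoluteValue Qbar ℝ := w.comp (f := j) j.injective
  have hW : ∀ x, W x = w (j x) := fun x => rfl
  have h := S15.final W (fun x y => by simpa [hW] using hna (j x) (j y)) p hp
    (by rw [hW, map_natCast, hw]) K d hd β hβ α hα γ hγinj hγ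
  have h2 := h.const_mul ((Module.finrank ℚ ↥K : ℝ)⁻¹)
  refine h2.congr fun m => ?_
  simp only [hW, map_sub]
  push_cast
  rw [mul_inv]
  ring
end
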